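/- arXiv:2109.04558 — 5 statements merged into one kernel-verified Lean document; each statement's English description precedes it below -/
import Mathlib

section
/- Let n ≥ 1 and let g be an n×n complex unitary matrix, and set ι(g) := δ_n g⁻¹ δ_n. Then for all 1 ≤ i ≤ j ≤ n, the left-justified minor of ι(g) on the row interval {i,…,j} satisfies Δ_{{i,…,j}}(ι(g)) = Σ_I Δ_I(g) · conj( Δ_{{1,…,j−i+1} ∪ I}(g) ), where the sum runs over all subsets I of {j−i+2,…,n} of cardinality i−1. -/
open Matrix Finset

/-- The minor of a square matrix `g` on row set `I` and column set `J`
(rows and columns listed in increasing order); defined to be `0` if `I` and `J`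
have different cardinalities. -/
noncomputable def minorOn {R : Type} [CommRing R] {n : ℕ} (g : Matrix (Fin n) (Fin n) R)
    (I J : Finset (Fin n)) : R :=
  if h : J.card = I.card then
    Matrix.det (Matrix.of fun a b : Fin I.card =>
      g ((I.orderIsoOfFin rfl a : Fin n)) ((J.orderIsoOfFin h b : Fin n)))
  else 0

/-- The left-justified minor `Δ_I(g)`: the minor on rows `I` and the first `|I|` columns. -/
noncomputable def leftMinor {R : Type} [CommRing R] {n : ℕ} (g : Matrix (Fin n) (Fin n) R)
    (I : Finset (Fin n)) : R :=
  minorOn g I (Finset.univ.filter fun j : Fin n => (j : ℕ) < I.card)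

/-- A complex number is a positive real. -/
def IsPosReal (z : ℂ) : Prop := 0 < z.re ∧ z.im = 0

/-- A complex number is a nonnegative real. -/
def IsNonnegReal (z : ℂ) : Prop := 0 ≤ z.re ∧ z.im = 0

/-- The diagonal sign matrix `δ_n = diag(1, −1, 1, …, (−1)^{n−1})`. -/
noncomputable def deltaMat (n : ℕ) : Matrix (Fin n) (Fin n) ℂ :=
  Matrix.diagonal fun i : Fin n => (-1 : ℂ) ^ (i : ℕ)

/-- The totally positive part `U_n^{>0}` of the unitary group: unitary matrices all of
whose left-justified minors are positive real numbers. -/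
def UnitaryTP (n : ℕ) : Set (Matrix (Fin n) (Fin n) ℂ) :=
  {g | g.conjTranspose * g = 1 ∧ ∀ I : Finset (Fin n), IsPosReal (leftMinor g I)}


/-- Grouping of a sum over all functions by their image, for an alternating weight `D`. -/
theorem sum_alternating_eq {n p : ℕ} (A : Matrix (Fin p) (Fin n) ℂ) (D : (Fin p → Fin n) → ℂ)
    (T : Finset (Fin n))
    (hperm : ∀ (f : Fin p → Fin n) (σ : Equiv.Perm (Fin p)),
      D (f ∘ σ) = ((Equiv.Perm.sign σ : ℤ) : ℂ) * D f)
    (hinj : ∀ f : Fin p → Fin n, ¬ Function.Injective f → D f = 0)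
    (hT : ∀ (f : Fin p → Fin n) (b : Fin p), f b ∉ T → D f = 0)
    (L : Finset (Fin n) → ℂ)
    (hL : ∀ (I : Finset (Fin n)) (h : I.card = p), I ⊆ T →
      L I = Matrix.det (Matrix.of fun a b : Fin p => A a (I.orderEmbOfFin h b)) *
        D (I.orderEmbOfFin h)) :
    ∑ f : Fin p → Fin n, (∏ b, A b (f b)) * D f = ∑ I ∈ Finset.powersetCard p T, L I := by
  classical
  have h1 : ∑ f : Fin p → Fin n, (∏ b, A b (f b)) * D f =
      ∑ f : Fin p → Fin n with (Function.Injective f ∧ ∀ b, f b ∈ T),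
        (∏ b, A b (f b)) * D f := by
    symm
    apply Finset.sum_filter_of_ne
    intro f _ hf
    have hD : D f ≠ 0 := right_ne_zero_of_mul hf
    refine ⟨?_, ?_⟩
    · by_contra hc
      exact hD (hinj f hc)
    · intro b
      by_contra hc
      exact hD (hT f b hc)
  rw [h1, ← Finset.sum_fiberwise_of_maps_to (t := Finset.powersetCard p T)
    (g := fun f : Fin p → Fin n => Finset.univ.image f)]
  · apply Finset.sum_congr rfl
    intro I hI
    obtain ⟨hIT, hIc⟩ := Finset.mem_powersetCard.1 hI
    rw [hL I hIc hIT, ← Matrix.det_transpose, Matrix.det_apply', Finset.sum_mul]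
    symm
    refine Finset.sum_bij (fun (σ : Equiv.Perm (Fin p)) _ => (I.orderEmbOfFin hIc) ∘ σ) ?_ ?_ ?_ ?_
    · intro σ _
      simp only [Finset.mem_filter, Finset.mem_univ, true_and]
      refine ⟨⟨(I.orderEmbOfFin hIc).injective.comp σ.injective, fun b => hIT ?_⟩, ?_⟩
      · exact Finset.orderEmbOfFin_mem I hIc _
      · ext x
        have := Finset.range_orderEmbOfFin I hIc
        rw [← Finset.mem_coe (s := I), ← this]
        simp only [Finset.mem_image, Finset.mem_univ, true_and, Function.comp, Set.mem_range]
        exact ⟨fun ⟨a, ha⟩ => ⟨σ a, ha⟩, fun ⟨a, ha⟩ => ⟨σ.symm a, by simpa using ha⟩⟩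
    · intro σ _ τ _ h
      ext1 b
      exact (I.orderEmbOfFin hIc).injective (congrFun h b)
    · intro f hf
      simp only [Finset.mem_filter, Finset.mem_univ, true_and] at hf
      obtain ⟨⟨hfi, -⟩, hfI⟩ := hf
      have hex : ∀ b, ∃ c, I.orderEmbOfFin hIc c = f b := by
        intro b
        have : f b ∈ Set.range (I.orderEmbOfFin hIc) := by
          rw [Finset.range_orderEmbOfFin, ← hfI]
          simp
        exact this
      choose s hs using hex
      have hsi : Function.Injective s := by
        intro a b hab
        apply hfi
        rw [← hs, ← hs, hab]
      refine ⟨Equiv.ofBijective s (Finite.injective_iff_bijective.1 hsi), Finset.mem_univ _, ?_⟩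
      funext b
      simp [hs]
    · intro σ _
      rw [hperm]
      simp only [Matrix.transpose_apply, Matrix.of_apply, Function.comp]
      ring
  · intro f hf
    simp only [Finset.mem_filter, Finset.mem_univ, true_and] at hf
    rw [Finset.mem_powersetCard]
    refine ⟨?_, ?_⟩
    · intro x hx
      obtain ⟨b, -, rfl⟩ := Finset.mem_image.1 hx
      exact hf.2 b
    · rw [Finset.card_image_of_injective _ hf.1]
      simp

/-- Evaluating a left minor through an explicit increasing enumeration of the rows. -/
theorem leftMinor_eq_det {n k : ℕ} (g : Matrix (Fin n) (Fin n) ℂ) (I : Finset (Fin n))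
    (hI : I.card = k) (hk : k ≤ n) (e : Fin k → Fin n) (he : StrictMono e) (hm : ∀ a, e a ∈ I) :
    leftMinor g I = Matrix.det (Matrix.of fun a b : Fin k => g (e a) (Fin.castLE hk b)) := by
  subst hI
  have hc : (Finset.univ.filter fun j : Fin n => (j : ℕ) < I.card).card = I.card := by
    rw [Fin.card_filter_val_lt]
    exact min_eq_right hk
  have h1 := Finset.orderEmbOfFin_unique rfl hm he
  have h2 := Finset.orderEmbOfFin_unique (f := Fin.castLE hk) hc
    (by intro x; simp) (Fin.strictMono_castLE hk)
  rw [leftMinor, minorOn, dif_pos hc]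
  congr 1
  ext a b
  simp only [Matrix.of_apply]
  rw [h1, h2]
  rfl

/-- The column rearrangement sign. -/
theorem det_block_swap {m p : ℕ} (N : Matrix (Fin (m + p)) (Fin (m + p)) ℂ) :
    (N.submatrix finSumFinEquiv (((Equiv.sumComm (Fin m) (Fin p)).trans finSumFinEquiv).trans
      (finCongr (Nat.add_comm p m)))).det = (-1) ^ (m * p) * N.det := by
  have := Matrix.det_reindex (finSumFinEquiv (m := m) (n := p)).symm
    (((Equiv.sumComm (Fin m) (Fin p)).trans finSumFinEquiv).trans
      (finCongr (Nat.add_comm p m))).symm N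
  rw [Matrix.reindex_apply] at this
  simp only [Equiv.symm_symm] at this
  have hinv : ((((Equiv.sumComm (Fin m) (Fin p)).trans finSumFinEquiv).trans
      (finCongr (Nat.add_comm p m))).symm.trans finSumFinEquiv) =
      (finSumFinEquiv.symm.trans (((Equiv.sumComm (Fin m) (Fin p)).trans finSumFinEquiv).trans
      (finCongr (Nat.add_comm p m)))).symm := by
    ext x
    rfl
  rw [this, hinv, Equiv.Perm.sign_symm, Equiv.Perm.sign_eq_prod_prod_Ioi]
  congr 1
  dsimp
  simp only [Units.coe_prod, Int.cast_prod]
  simp_rw [← finSumFinEquiv.prod_comp, ← Finset.prod_map_equiv finSumFinEquiv.symm]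
  simp only [Equiv.symm_apply_apply, ← Fin.val_fin_lt, Equiv.symm_symm, Function.comp_apply,
    ← Finset.prod_ite_mem_eq (Finset.map _ _), Finset.mem_map_equiv, Finset.mem_Ioi,
    Fintype.prod_sum_type, finSumFinEquiv_apply_left, Fin.val_castAdd, Equiv.sumComm_apply,
    Sum.swap_inl, finCongr_apply, Fin.val_cast,
    finSumFinEquiv_apply_right, Fin.val_natAdd, Sum.swap_inr, add_lt_add_iff_left]
  have q1 : ∀ (a b : Fin m) [i1 : Decidable ((a : ℕ) < b)] [i2 : Decidable ((a : ℕ) < b)],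
      (@ite _ ((a : ℕ) < b) i1
      (((@ite _ ((a : ℕ) < b) i2 1 (-1) : ℤˣ) : ℤ) : ℂ) 1) = 1 := by
    intro a b _ _; split_ifs <;> simp
  have q2 : ∀ (a b : Fin p) [i1 : Decidable ((a : ℕ) < b)] [i2 : Decidable ((a : ℕ) < b)],
      (@ite _ ((a : ℕ) < b) i1
      (((@ite _ ((a : ℕ) < b) i2 1 (-1) : ℤˣ) : ℤ) : ℂ) 1) = 1 := by
    intro a b _ _; split_ifs <;> simp
  have q3 : ∀ (a : Fin m) (b : Fin p) [i1 : Decidable ((a : ℕ) < m + b)] [i2 : Decidable (p + (a : ℕ) < b)],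
      (@ite _ ((a : ℕ) < m + b) i1
      (((@ite _ (p + (a : ℕ) < b) i2 1 (-1) : ℤˣ) : ℤ) : ℂ) 1) = -1 := by
    intro a b _ _; rw [if_pos (by omega), if_neg (by omega)]; simp
  have q4 : ∀ (a : Fin p) (b : Fin m) [i1 : Decidable (m + (a : ℕ) < b)] [i2 : Decidable ((a : ℕ) < p + b)],
      (@ite _ (m + (a : ℕ) < b) i1
      (((@ite _ ((a : ℕ) < p + b) i2 1 (-1) : ℤˣ) : ℤ) : ℂ) 1) = 1 := by
    intro a b _ _; rw [if_neg (by omega)]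
  refine Eq.trans (congrArg₂ (· * ·)
    (Finset.prod_congr rfl fun a _ => congrArg₂ (· * ·)
      (Finset.prod_congr rfl fun b _ => @q1 a b _ _)
      (Finset.prod_congr rfl fun b _ => @q3 a b _ _))
    (Finset.prod_congr rfl fun a _ => congrArg₂ (· * ·)
      (Finset.prod_congr rfl fun b _ => @q4 a b _ _)
      (Finset.prod_congr rfl fun b _ => @q2 a b _ _))) ?_
  simp [pow_mul, pow_right_comm]

theorem core_formula {n m p : ℕ} (hk : m + p ≤ n) (g H : Matrix (Fin n) (Fin n) ℂ)
    (hgH : gᵀ * H = 1) :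
    (-1) ^ (m * p) * Matrix.det (Matrix.of fun a b : Fin m =>
      H (Fin.castLE (by omega) a) ⟨p + b, by omega⟩) =
    ∑ I ∈ Finset.powersetCard p (Finset.univ.filter fun a : Fin n => m ≤ (a : ℕ)),
      leftMinor g I * leftMinor H ((Finset.univ.filter fun a : Fin n => (a : ℕ) < m) ∪ I) := by
  classical
  let c : Fin m ⊕ Fin p → Fin n :=
    Sum.elim (fun b => ⟨p + b, by omega⟩) (fun b => ⟨b, by omega⟩)
  let t : Fin m → Fin n := Fin.castLE (by omega)
  let D : (Fin p → Fin n) → ℂ := fun f => (H.submatrix (Sum.elim t f) c).det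
  let A : Matrix (Fin p) (Fin n) ℂ := Matrix.of fun b r => g r ⟨b, by omega⟩
  have hsq : ((-1 : ℂ) ^ (m * p)) * (-1) ^ (m * p) = 1 := by
    rw [← mul_pow]; simp
  have key : Matrix.det (Matrix.of fun a b : Fin m =>
      H (Fin.castLE (by omega) a) ⟨p + b, by omega⟩) = ∑ f : Fin p → Fin n, (∏ b, A b (f b)) * D f := by
    have e1 := MultilinearMap.map_sum
      ((MultilinearMap.currySum
        (Matrix.detRowAlternating (n := Fin m ⊕ Fin p) (R := ℂ)).toMultilinearMap)
          (fun a x => H (t a) (c x)))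
      (fun (b : Fin p) (r : Fin n) => A b r • (fun x => H r (c x)))
    simp only [MultilinearMap.map_smul_univ, MultilinearMap.currySum_apply'] at e1
    have e2 : ∀ f : Fin p → Fin n, (Matrix.detRowAlternating (n := Fin m ⊕ Fin p) (R := ℂ)).toMultilinearMap
        (Sum.elim (fun a x => H (t a) (c x)) (fun b x => H (f b) (c x))) = D f := by
      intro f
      change Matrix.det _ = Matrix.det _
      congr 1
      ext (a | a) x <;> rfl
    simp only [e2, smul_eq_mul] at e1
    rw [← e1]
    change _ = Matrix.det _
    have e3 : (Sum.elim (fun a x => H (t a) (c x))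
        (fun b => ∑ r, A b r • (fun x => H r (c x))) : Matrix (Fin m ⊕ Fin p) (Fin m ⊕ Fin p) ℂ) =
        Matrix.fromBlocks (Matrix.of fun a b : Fin m =>
          H (Fin.castLE (by omega) a) ⟨p + b, by omega⟩)
          (Matrix.of fun (a : Fin m) (b : Fin p) => H (t a) ⟨b, by omega⟩) 0 1 := by
      have hs : ∀ (b : Fin p) x, (∑ r, A b r • (fun x => H r (c x))) x =
          (1 : Matrix (Fin n) (Fin n) ℂ) ⟨b, by omega⟩ (c x) := by
        intro b x
        rw [← hgH, Finset.sum_apply, Matrix.mul_apply]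
        rfl
      ext (a | a) (x | x)
      · rfl
      · rfl
      · change (∑ r, A a r • (fun x => H r (c x))) _ = _
        rw [hs, Matrix.one_apply_ne]
        · rfl
        · simp only [c, Sum.elim_inl, ne_eq, Fin.mk.injEq]
          omega
      · change (∑ r, A a r • (fun x => H r (c x))) _ = _
        rw [hs]
        simp [c, Matrix.one_apply, Fin.ext_iff]
    rw [e3, Matrix.det_fromBlocks_zero₂₁, Matrix.det_one, mul_one]
  rw [key, sum_alternating_eq A D (Finset.univ.filter fun a : Fin n => m ≤ (a : ℕ)) ?_ ?_ ?_
    (fun I => (-1) ^ (m * p) * (leftMinor g I * leftMinor H ((Finset.univ.filter fun a : Fin n => (a : ℕ) < m) ∪ I))) ?_,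
    ← Finset.mul_sum, ← mul_assoc, hsq, one_mul]
  · intro f σ
    have := Matrix.det_permute (Equiv.sumCongr (Equiv.refl (Fin m)) σ) (H.submatrix (Sum.elim t f) c)
    rw [Equiv.Perm.sign_sumCongr] at this
    simp only [Equiv.Perm.sign_refl, one_mul] at this
    rw [← this]
    simp only [D]
    congr 1
    ext (a | a) x <;> rfl
  · intro f hf
    simp only [Function.Injective, not_forall] at hf
    obtain ⟨a, b, hab, hne⟩ := hf
    apply Matrix.det_zero_of_row_eq (i := Sum.inr a) (j := Sum.inr b) (by simpa using hne)
    funext x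
    simp [hab]
  · intro f b hb
    simp only [Finset.mem_filter, Finset.mem_univ, true_and, not_le] at hb
    apply Matrix.det_zero_of_row_eq (i := Sum.inr b) (j := Sum.inl ⟨f b, hb⟩) (by simp)
    funext x
    simp [t]
  · intro I hI hIT
    have hIm : ∀ x ∈ I, m ≤ (x : ℕ) := fun x hx => by simpa using hIT hx
    rw [leftMinor_eq_det g I hI (by omega) _ (I.orderEmbOfFin hI).strictMono
      (fun a => Finset.orderEmbOfFin_mem I hI a)]
    have hcard : ((Finset.univ.filter fun a : Fin n => (a : ℕ) < m) ∪ I).card = m + p := by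
      rw [Finset.card_union_of_disjoint, Fin.card_filter_val_lt, hI, min_eq_right (by omega)]
      rw [Finset.disjoint_left]
      intro x hx hx'
      have := hIm x hx'
      simp at hx
      omega
    have hmono : StrictMono (Fin.append t (I.orderEmbOfFin hI)) := by
      intro x y
      refine Fin.addCases (fun x => ?_) (fun x => ?_) x <;>
      refine Fin.addCases (fun y => ?_) (fun y => ?_) y <;> intro h
      · simp only [Fin.lt_def, Fin.val_castAdd] at h
        simp only [Fin.append_left, t, Fin.lt_def, Fin.val_castLE]
        exact h
      · have := hIm _ (Finset.orderEmbOfFin_mem I hI y)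
        simp only [Fin.append_left, Fin.append_right, t, Fin.lt_def, Fin.val_castLE]
        omega
      · simp only [Fin.lt_def, Fin.val_natAdd, Fin.val_castAdd] at h
        omega
      · simp only [Fin.lt_def, Fin.val_natAdd, add_lt_add_iff_left] at h
        simp only [Fin.append_right]
        exact (I.orderEmbOfFin hI).strictMono h
    rw [leftMinor_eq_det H _ hcard hk _ hmono]
    · have hsw := det_block_swap (Matrix.of fun a b : Fin (m + p) =>
        H (Fin.append t (I.orderEmbOfFin hI) a) (Fin.castLE hk b))
      have hD : D (I.orderEmbOfFin hI) = (-1) ^ (m * p) * Matrix.det (Matrix.of fun a b : Fin (m + p) =>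
        H (Fin.append t (I.orderEmbOfFin hI) a) (Fin.castLE hk b)) := by
        rw [← hsw]
        simp only [D]
        congr 1
        ext (a | a) (b | b) <;> simp [c] <;> congr 1 <;> ext <;> simp [Nat.add_comm]
      rw [hD, ← Matrix.det_transpose]
      have : (Matrix.of fun a b : Fin p => g (I.orderEmbOfFin hI a) (Fin.castLE (by omega) b))ᵀ =
        Matrix.of fun a b : Fin p => A a (I.orderEmbOfFin hI b) := rfl
      rw [this]
      ring
    · intro x
      refine Fin.addCases (fun x => ?_) (fun x => ?_) x
      · simp [t]
      · simp

theorem leftMinor_map_conj {n : ℕ} (g : Matrix (Fin n) (Fin n) ℂ) (I : Finset (Fin n)) :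
    leftMinor (g.map (starRingEnd ℂ)) I = (starRingEnd ℂ) (leftMinor g I) := by
  unfold leftMinor minorOn
  split_ifs
  · rw [RingHom.map_det]
    rfl
  · simp

theorem twist_leftMinor_formula {n : ℕ} (hn : 1 ≤ n) (g : Matrix (Fin n) (Fin n) ℂ)
    (hg : g.conjTranspose * g = 1) (i j : Fin n) (hij : i ≤ j) :
    leftMinor (deltaMat n * g⁻¹ * deltaMat n) (Finset.Icc i j) =
      ∑ I ∈ Finset.powersetCard (i : ℕ)
          (Finset.univ.filter fun a : Fin n => (j : ℕ) - (i : ℕ) + 1 ≤ (a : ℕ)),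
        leftMinor g I *
          (starRingEnd ℂ) (leftMinor g
            ((Finset.univ.filter fun a : Fin n => (a : ℕ) ≤ (j : ℕ) - (i : ℕ)) ∪ I)) := by
  have hij' : (i : ℕ) ≤ j := hij
  have hj := j.isLt
  have hgH : gᵀ * g.map (starRingEnd ℂ) = 1 := by
    have := congrArg Matrix.transpose hg
    rw [Matrix.transpose_mul, Matrix.transpose_one] at this
    rw [← this]
    rfl
  have hinv : g⁻¹ = g.conjTranspose := Matrix.inv_eq_left_inv hg
  have hc := core_formula (m := (j : ℕ) - i + 1) (p := i) (by omega) g _ hgH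
  simp only [leftMinor_map_conj, Nat.lt_succ_iff] at hc
  rw [← hc, hinv, leftMinor_eq_det (k := (j : ℕ) - i + 1) _ _ (by rw [Fin.card_Icc]; omega) (by omega)
    (fun a => ⟨i + a, by omega⟩) (by intro a b h; simp only [Fin.lt_def] at h ⊢; omega)
    (by intro a; simp [Fin.le_def]; omega)]
  rw [← Matrix.det_transpose]
  have hM : (Matrix.of fun a b : Fin ((j : ℕ) - i + 1) => (deltaMat n * gᴴ * deltaMat n)
      ⟨i + a, by omega⟩ (Fin.castLE (by omega) b))ᵀ =
      Matrix.of fun a b : Fin ((j : ℕ) - i + 1) => (-1 : ℂ) ^ (a : ℕ) * (Matrix.of fun a b : Fin ((j : ℕ) - i + 1) =>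
        (-1 : ℂ) ^ ((i : ℕ) + b) * (g.map (starRingEnd ℂ)) (Fin.castLE (by omega) a) ⟨i + b, by omega⟩) a b := by
    ext a b
    simp [deltaMat, Matrix.mul_diagonal, Matrix.diagonal_mul]
    ring
  rw [hM, Matrix.det_mul_column]
  have hr := Matrix.det_mul_row (fun b : Fin ((j : ℕ) - i + 1) => (-1 : ℂ) ^ ((i : ℕ) + b))
    (Matrix.of fun a b : Fin ((j : ℕ) - i + 1) =>
      (g.map (starRingEnd ℂ)) (Fin.castLE (by omega) a) ⟨i + b, by omega⟩)
  refine (congrArg _ hr).trans ?_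
  rw [← mul_assoc]
  congr 1
  simp only [pow_add, Finset.prod_mul_distrib, Finset.prod_const, Finset.card_univ, Fintype.card_fin]
  rw [mul_left_comm, ← Finset.prod_mul_distrib]
  simp [← mul_pow, mul_comm, pow_mul, pow_succ]
end

section
/- Let n ≥ 1. The involution ι(g) := δ_n g⁻¹ δ_n of the unitary group U_n preserves total positivity and total nonnegativity: if g ∈ U_n has every left-justified minor a positive real number, then every left-justified minor of δ_n g⁻¹ δ_n is a positive real number (so ι maps U_n^{>0} onto itself), and if g lies in the closure U_n^{≥0} of U_n^{>0}, then δ_n g⁻¹ δ_n lies in U_n^{≥0} as well. -/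
open Matrix Finset

/-- The totally nonnegative part `U_n^{≥0}`: the closure of `U_n^{>0}` in the space of
`n×n` complex matrices. -/
noncomputable def UnitaryTNN (n : ℕ) : Set (Matrix (Fin n) (Fin n) ℂ) :=
  closure (UnitaryTP n)

theorem pos_iff (z : ℂ) : IsPosReal z ↔ ∃ x : ℝ, 0 < x ∧ z = x := by
  constructor
  · rintro ⟨h1, h2⟩
    exact ⟨z.re, h1, Complex.ext (by simp) (by simp [h2])⟩
  · rintro ⟨x, hx, rfl⟩
    exact ⟨by simpa using hx, by simp⟩

theorem nonneg_iff (z : ℂ) : IsNonnegReal z ↔ ∃ x : ℝ, 0 ≤ x ∧ z = x := by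
  constructor
  · rintro ⟨h1, h2⟩
    exact ⟨z.re, h1, Complex.ext (by simp) (by simp [h2])⟩
  · rintro ⟨x, hx, rfl⟩
    exact ⟨by simpa using hx, by simp⟩

theorem pos_mul {z w : ℂ} (hz : IsPosReal z) (hw : IsPosReal w) : IsPosReal (z * w) := by
  rw [pos_iff] at *
  obtain ⟨x, hx, rfl⟩ := hz
  obtain ⟨y, hy, rfl⟩ := hw
  exact ⟨x * y, by positivity, by push_cast; rfl⟩

theorem pos_add {z w : ℂ} (hz : IsPosReal z) (hw : IsPosReal w) : IsPosReal (z + w) := by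
  rw [pos_iff] at *
  obtain ⟨x, hx, rfl⟩ := hz
  obtain ⟨y, hy, rfl⟩ := hw
  exact ⟨x + y, by positivity, by push_cast; rfl⟩

theorem pos_cancel {z w : ℂ} (hz : IsPosReal z) (hw : IsPosReal (z * w)) : IsPosReal w := by
  rw [pos_iff] at *
  obtain ⟨x, hx, rfl⟩ := hz
  obtain ⟨y, hy, h⟩ := hw
  refine ⟨y / x, by positivity, ?_⟩
  have : (x : ℂ) ≠ 0 := by exact_mod_cast hx.ne'
  push_cast
  rw [← h]
  field_simp

theorem pos_ne {z : ℂ} (hz : IsPosReal z) : z ≠ 0 := by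
  rintro rfl
  simpa using hz.1

theorem pos_conj {z : ℂ} (hz : IsPosReal z) : IsPosReal (star z) := by
  rw [pos_iff] at *
  obtain ⟨x, hx, rfl⟩ := hz
  exact ⟨x, hx, by simp⟩

/-- Left-justified determinants of an infinite array. -/
noncomputable def ldet (M : ℕ → ℕ → ℂ) {k : ℕ} (f : Fin k → ℕ) : ℂ :=
  Matrix.det (Matrix.of fun r c : Fin k => M (f r) c)

theorem ldet_perm (M : ℕ → ℕ → ℂ) {k : ℕ} (f : Fin k → ℕ) (σ : Equiv.Perm (Fin k)) :
    ldet M (f ∘ σ) = (Equiv.Perm.sign σ : ℤ) * ldet M f := by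
  have := Matrix.det_permute σ (Matrix.of fun r c : Fin k => M (f r) c)
  exact this

theorem ldet_ins_cons (M : ℕ → ℕ → ℂ) {k : ℕ} (x : Fin k → ℕ) (q : Fin (k + 1)) (j : ℕ) :
    ldet M (q.insertNth j x : Fin (k + 1) → ℕ) = (-1) ^ (q : ℕ) * ldet M (Fin.cons j x : Fin (k + 1) → ℕ) := by
  rw [← Fin.cons_comp_cycleRange, ldet_perm, Fin.sign_cycleRange]
  simp

theorem ldet_ins (M : ℕ → ℕ → ℂ) {k : ℕ} (x : Fin k → ℕ) (q : Fin (k + 1)) (j : ℕ) :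
    ldet M (q.insertNth j x : Fin (k + 1) → ℕ) = (-1) ^ (q + k : ℕ) * ldet M (Fin.snoc x j : Fin (k + 1) → ℕ) := by
  have h : (Fin.snoc x j : Fin (k + 1) → ℕ) = (Fin.last k).insertNth j x := by
    rw [Fin.insertNth_last']
  rw [h, ldet_ins_cons, ldet_ins_cons, Fin.val_last, ← mul_assoc, ← pow_add]
  congr 1
  rw [pow_add, pow_add, mul_assoc, ← pow_add, ← two_mul, pow_mul]
  simp

theorem ldet_schur (M : ℕ → ℕ → ℂ) {m : ℕ} (S : Fin m → ℕ) (hS : ldet M S ≠ 0) :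
    ∃ u w : ℕ → ℂ, (∀ x, ldet M (Fin.snoc S x : Fin (m + 1) → ℕ) = ldet M S * u x) ∧
      ∀ x y, ldet M (Fin.snoc (Fin.snoc S x : Fin (m + 1) → ℕ) y : Fin (m + 2) → ℕ) =
        ldet M S * (u x * w y - w x * u y) := by
  let A : Matrix (Fin m) (Fin m) ℂ := Matrix.of fun r c => M (S r) c
  have hA : IsUnit A.det := (isUnit_iff_ne_zero.2 hS)
  let _ : Invertible A := Matrix.invertibleOfIsUnitDet A hA
  let z : ℕ → ℕ → ℂ := fun x c =>
    M x c - ((Matrix.of fun (_ : Unit) (t : Fin m) => M x t) * ⅟A *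
      (Matrix.of fun (t : Fin m) (_ : Unit) => M (S t) c)) () ()
  refine ⟨fun x => z x m, fun x => z x (m + 1), fun x => ?_, fun x y => ?_⟩
  · have h := Matrix.det_fromBlocks₁₁ A (Matrix.of fun (t : Fin m) (c : Fin 1) => M (S t) (m + c))
      (Matrix.of fun (_ : Fin 1) (t : Fin m) => M x t) (Matrix.of fun (_ : Fin 1) (c : Fin 1) => M x (m + c))
    rw [Matrix.det_fin_one] at h
    have e : ldet M (Fin.snoc S x : Fin (m + 1) → ℕ) = _ := (Matrix.det_submatrix_equiv_self
      (finSumFinEquiv (m := m) (n := 1)) _).symm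
    rw [e]
    convert h using 1
    · congr 1
      ext (r | r) (c | c) <;> simp [A, Fin.snoc]
    · simp [ldet, A, z, Matrix.mul_apply]
  · have h := Matrix.det_fromBlocks₁₁ A (Matrix.of fun (t : Fin m) (c : Fin 2) => M (S t) (m + c))
      (Matrix.of fun (r : Fin 2) (t : Fin m) => M (![x, y] r) t) (Matrix.of fun (r : Fin 2) (c : Fin 2) => M (![x, y] r) (m + c))
    rw [Matrix.det_fin_two] at h
    have e : ldet M (Fin.snoc (Fin.snoc S x : Fin (m + 1) → ℕ) y : Fin (m + 2) → ℕ) = _ := (Matrix.det_submatrix_equiv_self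
      (finSumFinEquiv (m := m) (n := 2)) _).symm
    rw [e]
    convert h using 1
    · congr 1
      ext (r | r) (c | c)
      · simp [A, Fin.snoc]
        rfl
      · simp [A, Fin.snoc]
        rfl
      · fin_cases r <;> simp [Fin.snoc]
      · fin_cases r <;> simp [Fin.snoc]
    · simp [ldet, A, z, Matrix.mul_apply]

theorem ldet_plucker (M : ℕ → ℕ → ℂ) {m : ℕ} (f : Fin (m + 2) → ℕ) (r : Fin (m + 1)) (j : ℕ)
    (hS : ldet M (fun t : Fin m => f t.castSucc.succ) ≠ 0) :
    ldet M (r.insertNth j (fun t : Fin m => f t.castSucc.succ) : Fin (m + 1) → ℕ) * ldet M f =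
      ldet M (fun t : Fin (m + 1) => f t.castSucc) *
        ldet M (r.castSucc.insertNth j (fun t : Fin (m + 1) => f t.succ) : Fin (m + 2) → ℕ) +
      ldet M (fun t : Fin (m + 1) => f t.succ) *
        ldet M (r.succ.insertNth j (fun t : Fin (m + 1) => f t.castSucc) : Fin (m + 2) → ℕ) := by
  obtain ⟨u, w, h1, h2⟩ := ldet_schur M _ hS
  set S : Fin m → ℕ := fun t : Fin m => f t.castSucc.succ with hSd
  set i := f 0
  set l := f (Fin.last _)
  have f2 : (fun t : Fin (m + 1) => f t.succ) = (Fin.snoc S l : Fin (m + 1) → ℕ) := by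
    ext t
    refine Fin.lastCases ?_ (fun t => ?_) t
    · simp [l]
    · simp [S]
  have f1 : (fun t : Fin (m + 1) => f t.castSucc) = (Fin.insertNth 0 i S : Fin (m + 1) → ℕ) := by
    ext t
    refine Fin.cases ?_ (fun t => ?_) t
    · simp [i]
    · simp [S]
  have f0 : f = (Fin.insertNth 0 i (Fin.snoc S l : Fin (m + 1) → ℕ) : Fin (m + 2) → ℕ) := by
    rw [← f2]
    ext t
    refine Fin.cases ?_ (fun t => ?_) t
    · simp [i]
    · simp
  have f3 : ∀ j, (Fin.snoc (Fin.insertNth 0 i S : Fin (m + 1) → ℕ) j : Fin (m + 2) → ℕ) =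
      (Fin.insertNth 0 i (Fin.snoc S j : Fin (m + 1) → ℕ) : Fin (m + 2) → ℕ) := by
    intro j
    rw [Fin.insertNth_zero', Fin.insertNth_zero', Fin.cons_snoc_eq_snoc_cons]
  have e0 : ldet M f = (-1) ^ (m + 1) * (ldet M S * (u l * w i - w l * u i)) := by
    rw [f0, ldet_ins, h2]; simp
  rw [e0, f2, f1, ldet_ins, ldet_ins, ldet_ins, ldet_ins, f3, ldet_ins, h1, h1, h1, h2, h2]
  simp only [Fin.val_zero, Fin.val_succ, Fin.val_castSucc, pow_add, pow_zero, pow_one]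
  have : ((-1 : ℂ) ^ m) ^ 2 = 1 := by rw [← pow_mul, mul_comm, pow_mul]; simp
  ring

theorem strictMono_ins {m : ℕ} (x : Fin m → ℕ) (hx : StrictMono x) (q : Fin (m + 1)) (j : ℕ)
    (h1 : ∀ t, t.castSucc < q → x t < j) (h2 : ∀ t, q ≤ t.castSucc → j < x t) :
    StrictMono (q.insertNth j x : Fin (m + 1) → ℕ) := by
  intro a b
  refine Fin.succAboveCases q ?_ (fun a => ?_) a <;> refine Fin.succAboveCases q ?_ (fun b => ?_) b
  · simp
  · intro h
    simp only [Fin.insertNth_apply_same, Fin.insertNth_apply_succAbove]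
    apply h2
    exact (Fin.lt_succAbove_iff_le_castSucc _ _).1 h
  · intro h
    simp only [Fin.insertNth_apply_same, Fin.insertNth_apply_succAbove]
    apply h1
    exact (Fin.succAbove_lt_iff_castSucc_lt _ _).1 h
  · intro h
    simp only [Fin.insertNth_apply_succAbove]
    exact hx ((Fin.succAbove_lt_succAbove_iff).1 h)

/-- A Fekete-type criterion. -/
theorem fekete (M : ℕ → ℕ → ℂ) (n : ℕ)
    (h : ∀ a k, a + k ≤ n → IsPosReal (ldet M (fun r : Fin k => a + (r : ℕ)))) :
    ∀ k d (f : Fin k → ℕ), StrictMono f → (∀ r, f r < n) → (∀ r s, f r ≤ f s + d) →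
      IsPosReal (ldet M f) := by
  intro k
  induction k using Nat.strong_induction_on with
  | _ k IHk =>
  intro d
  induction d using Nat.strong_induction_on with
  | _ d IHd =>
  intro f hf hn hd
  match k, f with
  | 0, f =>
    have := h 0 0 (Nat.zero_le _)
    convert this using 2
  | 1, f =>
    have := h (f 0) 1 (hn 0)
    convert this using 2
    ext r; rw [Subsingleton.elim r 0]; simp
  | m + 2, f =>
    by_cases hg : ∃ r : Fin (m + 1), f r.castSucc + 1 < f r.succ
    · obtain ⟨r, hr⟩ := hg
      set j := f r.castSucc + 1 with hj
      have hs : StrictMono (fun t : Fin (m + 1) => f t.succ) :=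
        hf.comp (Fin.strictMono_succ)
      have hc : StrictMono (fun t : Fin (m + 1) => f t.castSucc) :=
        hf.comp (Fin.strictMono_castSucc)
      have hG : StrictMono (r.succ.insertNth j (fun t : Fin (m + 1) => f t.castSucc) :
          Fin (m + 2) → ℕ) := by
        apply strictMono_ins _ hc
        · intro t ht
          have : f t.castSucc ≤ f r.castSucc := hf.monotone (by
            simp only [Fin.lt_def, Fin.le_def, Fin.val_castSucc, Fin.val_succ] at ht ⊢; omega)
          omega
        · intro t ht
          have : f r.succ ≤ f t.castSucc := hf.monotone (by
            simp only [Fin.lt_def, Fin.le_def, Fin.val_castSucc, Fin.val_succ] at ht ⊢; omega)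
          omega
      have hH : StrictMono (r.castSucc.insertNth j (fun t : Fin (m + 1) => f t.succ) :
          Fin (m + 2) → ℕ) := by
        apply strictMono_ins _ hs
        · intro t ht
          have : f t.succ ≤ f r.castSucc := hf.monotone (by
            simp only [Fin.lt_def, Fin.le_def, Fin.val_castSucc, Fin.val_succ] at ht ⊢; omega)
          omega
        · intro t ht
          have : f r.succ ≤ f t.succ := hf.monotone (by
            simp only [Fin.lt_def, Fin.le_def, Fin.val_castSucc, Fin.val_succ] at ht ⊢; omega)
          omega
      have hSm : StrictMono (fun t : Fin m => f t.castSucc.succ) :=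
        hs.comp Fin.strictMono_castSucc
      have hA : StrictMono (r.insertNth j (fun t : Fin m => f t.castSucc.succ) :
          Fin (m + 1) → ℕ) := by
        apply strictMono_ins _ hSm
        · intro t ht
          have : f t.castSucc.succ ≤ f r.castSucc := hf.monotone (by
            simp only [Fin.lt_def, Fin.le_def, Fin.val_castSucc, Fin.val_succ] at ht ⊢; omega)
          omega
        · intro t ht
          have : f r.succ ≤ f t.castSucc.succ := hf.monotone (by
            simp only [Fin.lt_def, Fin.le_def, Fin.val_castSucc, Fin.val_succ] at ht ⊢; omega)
          omega
      have hjn : j < n := hr.trans (hn _)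
      have b0 : ∀ t, f 0 ≤ f t := fun t => hf.monotone (Fin.zero_le t)
      have bl : ∀ t, f t ≤ f (Fin.last _) := fun t => hf.monotone (Fin.le_last t)
      have d0 := hd (Fin.last _) 0
      have b0' : ∀ t : Fin (m + 1), f 0 < f t.succ := fun t => hf (Fin.succ_pos t)
      have bl' : ∀ t : Fin (m + 1), f t.castSucc < f (Fin.last _) := fun t => hf (Fin.castSucc_lt_last t)
      have hj0 : f 0 < j := by have := b0 r.castSucc; omega
      have hjl : j < f (Fin.last _) := by have := bl r.succ; omega
      have b00 := bl' 0
      rw [Fin.castSucc_zero] at b00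
      have pS := IHk m (by omega) n _ hSm (fun t => hn _) (fun t s => by have := hn t.castSucc.succ; omega)
      have pl := ldet_plucker M f r j (pos_ne pS)
      have pA := IHk (m + 1) (by omega) n _ hA (by
        intro t; refine Fin.succAboveCases r ?_ (fun t => ?_) t <;> simp [hjn, hn]) (by
        intro t s
        refine le_trans ?_ (Nat.le_add_left _ _)
        refine Fin.succAboveCases r ?_ (fun t => ?_) t <;> simp [hjn.le, (hn _).le])
      have p1 := IHk (m + 1) (by omega) n _ hc (fun t => hn _) (fun t s => by have := hn t.castSucc; omega)
      have p2 := IHk (m + 1) (by omega) n _ hs (fun t => hn _) (fun t s => by have := hn t.succ; omega)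
      have dpos : 0 < d := by omega
      have pH := IHd (d - 1) (by omega) _ hH (by
        intro t; refine Fin.succAboveCases r.castSucc ?_ (fun t => ?_) t <;> simp [hjn, hn]) (by
        have u : ∀ t, (r.castSucc.insertNth j (fun t : Fin (m + 1) => f t.succ) : Fin (m + 2) → ℕ) t
            ≤ f (Fin.last _) := by
          intro t
          refine Fin.succAboveCases r.castSucc ?_ (fun t => ?_) t
          · simpa using hjl.le
          · simpa using bl _
        have v : ∀ t, f 0 + 1 ≤
            (r.castSucc.insertNth j (fun t : Fin (m + 1) => f t.succ) : Fin (m + 2) → ℕ) t := by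
          intro t
          refine Fin.succAboveCases r.castSucc ?_ (fun t => ?_) t
          · simpa using hj0
          · simpa using b0' _
        intro t s
        have := u t
        have := v s
        omega)
      have pG := IHd (d - 1) (by omega) _ hG (by
        intro t; refine Fin.succAboveCases r.succ ?_ (fun t => ?_) t <;> simp [hjn, hn]) (by
        have u : ∀ t, (r.succ.insertNth j (fun t : Fin (m + 1) => f t.castSucc) : Fin (m + 2) → ℕ) t
            + 1 ≤ f (Fin.last _) := by
          intro t
          refine Fin.succAboveCases r.succ ?_ (fun t => ?_) t
          · simpa using hjl
          · simpa using bl' _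
        have v : ∀ t, f 0 ≤
            (r.succ.insertNth j (fun t : Fin (m + 1) => f t.castSucc) : Fin (m + 2) → ℕ) t := by
          intro t
          refine Fin.succAboveCases r.succ ?_ (fun t => ?_) t
          · simpa using hj0.le
          · simpa using b0 _
        intro t s
        have := u t
        have := v s
        omega)
      apply pos_cancel pA
      rw [pl]
      exact pos_add (pos_mul p1 pH) (pos_mul p2 pG)
    · push Not at hg
      have key : ∀ t : Fin (m + 2), f t = f 0 + t := by
        intro t
        induction t using Fin.induction with
        | zero => simp
        | succ t ih =>
          have h1 := hg t
          have h2 : f t.castSucc < f t.succ := hf (Fin.castSucc_lt_succ)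
          simp only [Fin.val_castSucc, Fin.val_succ] at ih ⊢
          omega
      have := h (f 0) (m + 2) (by
        have h1 := hn (Fin.last _)
        rw [key, Fin.val_last] at h1
        omega)
      convert this using 2
      ext t; exact key t

theorem leftMinor_eq {n m : ℕ} (g : Matrix (Fin n) (Fin n) ℂ) (I : Finset (Fin n))
    (h : I.card = m) (hm : m ≤ n) :
    leftMinor g I = Matrix.det (Matrix.of fun a b : Fin m =>
      g (I.orderEmbOfFin h a) (Fin.castLE hm b)) := by
  subst h
  have hc : (Finset.univ.filter fun j : Fin n => (j : ℕ) < I.card).card = I.card := by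
    rw [Fin.card_filter_val_lt]
    omega
  rw [leftMinor, minorOn, dif_pos hc]
  congr 1
  ext a b
  simp only [Matrix.of_apply, Finset.coe_orderIsoOfFin_apply]
  congr 1
  have := Finset.orderEmbOfFin_unique hc (f := Fin.castLE hm) (by
    intro x; simp) (Fin.strictMono_castLE hm)
  rw [← this]

theorem leftMinor_pos {n m : ℕ} (g : Matrix (Fin n) (Fin n) ℂ)
    (hg : ∀ I : Finset (Fin n), IsPosReal (leftMinor g I)) (hm : m ≤ n) (f : Fin m → Fin n)
    (hf : StrictMono f) :
    IsPosReal (Matrix.det (Matrix.of fun a b : Fin m => g (f a) (Fin.castLE hm b))) := by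
  have hc : (Finset.univ.image f).card = m := by
    rw [Finset.card_image_of_injective _ hf.injective]; simp
  have := hg (Finset.univ.image f)
  rw [leftMinor_eq g _ hc hm, ← Finset.orderEmbOfFin_unique hc (f := f) (by simp) hf] at this
  exact this

/-- Unsorted Cauchy–Binet formula. -/
theorem cauchy_binet {n m : ℕ} (Y X : Matrix (Fin n) (Fin m) ℂ) :
    (m.factorial : ℂ) * (Yᵀ * X).det =
      ∑ f : Fin m → Fin n, (Y.submatrix f id).det * (X.submatrix f id).det := by
  have h1 : (Yᵀ * X).det = ∑ f : Fin m → Fin n, (∏ i, Y (f i) i) * (X.submatrix f id).det := by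
    have e : (Yᵀ * X) = fun i => ∑ j, Y j i • X j := by
      ext i c
      simp [Matrix.mul_apply]
    have := (Matrix.detRowAlternating (R := ℂ) (n := Fin m)).toMultilinearMap.map_sum
      (fun i (j : Fin n) => Y j i • X j)
    rw [e]
    refine this.trans ?_
    refine Finset.sum_congr rfl fun f _ => ?_
    have := (Matrix.detRowAlternating (R := ℂ) (n := Fin m)).toMultilinearMap.map_smul_univ
      (fun i => Y (f i) i) (fun i => X (f i))
    exact this
  have h2 : ∀ σ : Equiv.Perm (Fin m), (Yᵀ * X).det = ∑ f : Fin m → Fin n,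
      (((Equiv.Perm.sign σ : ℤ) : ℂ) * ∏ i, Y (f (σ i)) i) * (X.submatrix f id).det := by
    intro σ
    rw [h1, ← Equiv.sum_comp (Equiv.arrowCongr σ.symm (Equiv.refl (Fin n)))]
    refine Finset.sum_congr rfl fun f _ => ?_
    have := Matrix.det_permute σ (X.submatrix f id)
    have e : X.submatrix ((Equiv.arrowCongr σ.symm (Equiv.refl (Fin n))) f) id =
      (X.submatrix f id).submatrix σ id := rfl
    rw [e, this]
    simp only [Equiv.arrowCongr_apply, Equiv.symm_symm, Function.comp, Equiv.refl_apply]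
    ring
  have h3 : (m.factorial : ℂ) * (Yᵀ * X).det = ∑ _σ : Equiv.Perm (Fin m), (Yᵀ * X).det := by
    simp [Fintype.card_perm]
  rw [h3, Finset.sum_congr rfl fun σ _ => h2 σ, Finset.sum_comm]
  refine Finset.sum_congr rfl fun f _ => ?_
  rw [← Finset.sum_mul, Matrix.det_apply' (Y.submatrix f id)]
  rfl

theorem rot_pow (m j : ℕ) (x : Fin m) : (((finRotate m) ^ j) x : ℕ) = (x + j) % m := by
  induction j with
  | zero => simp [Nat.mod_eq_of_lt x.2]
  | succ j ih =>
    rw [pow_succ', Equiv.Perm.mul_apply]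
    match m with
    | 0 => exact x.elim0
    | m + 1 =>
      rw [finRotate_apply, Fin.val_add, ih, ← add_assoc, Fin.val_one', ← Nat.add_mod]

theorem exists_rot (k a : ℕ) : ∃ ρ : Equiv.Perm (Fin (k + a)),
    (∀ c : Fin k, (ρ (Fin.castAdd a c) : ℕ) = a + c) ∧
    (∀ t : Fin a, (ρ (Fin.natAdd k t) : ℕ) = t) ∧
    ((Equiv.Perm.sign ρ : ℤ) : ℂ) = (-1) ^ (a * k) := by
  refine ⟨(finRotate (k + a)) ^ a, fun c => ?_, fun t => ?_, ?_⟩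
  · rw [rot_pow, Fin.val_castAdd, Nat.mod_eq_of_lt (by omega), add_comm]
  · rw [rot_pow, Fin.val_natAdd, show k + (t : ℕ) + a = t + (k + a) by ring, Nat.add_mod_right,
      Nat.mod_eq_of_lt (by omega)]
  · rw [map_pow, sign_finRotate, ← pow_mul]
    push_cast
    rcases a with _ | a
    · simp
    · rw [show k + (a + 1) - 1 = k + a by omega, add_mul, pow_add]
      have : Even (a * (a + 1)) := Nat.even_mul_succ_self a
      rw [this.neg_one_pow, mul_one, mul_comm]

/-- The auxiliary matrix `[e_1 … e_k | conj g_1 … conj g_a]`. -/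
noncomputable def auxY {n : ℕ} (g : Matrix (Fin n) (Fin n) ℂ) (k a : ℕ) (h : k + a ≤ n) :
    Matrix (Fin n) (Fin (k + a)) ℂ :=
  Matrix.of fun r c => Fin.addCases (fun c : Fin k => if (r : ℕ) = c then (1 : ℂ) else 0)
    (fun t : Fin a => star (g r (Fin.castLE (by omega) t))) c

/-- The first `k + a` columns. -/
def auxX {n : ℕ} (g : Matrix (Fin n) (Fin n) ℂ) (k a : ℕ) (h : k + a ≤ n) :
    Matrix (Fin n) (Fin (k + a)) ℂ :=
  Matrix.of fun r c => g r (Fin.castLE h c)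

theorem auxY_det_pos {n : ℕ} (g : Matrix (Fin n) (Fin n) ℂ)
    (hg : ∀ I : Finset (Fin n), IsPosReal (leftMinor g I)) (k a : ℕ) (h : k + a ≤ n)
    (f : Fin (k + a) → Fin n) (hf : StrictMono f)
    (hk : ∀ c : Fin k, (f (Fin.castAdd a c) : ℕ) = c) :
    IsPosReal ((auxY g k a h).submatrix f id).det := by
  rw [← Matrix.det_submatrix_equiv_self (finSumFinEquiv (m := k) (n := a))]
  have e : ((auxY g k a h).submatrix f id).submatrix (finSumFinEquiv (m := k) (n := a))
      (finSumFinEquiv (m := k) (n := a)) = Matrix.fromBlocks 1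
        (Matrix.of fun r t => star (g (f (Fin.castAdd a r)) (Fin.castLE (by omega) t))) 0
        ((Matrix.of fun r t : Fin a => g (f (Fin.natAdd k r)) (Fin.castLE (by omega) t)).map star) := by
    ext (r | r) (c | c)
    · simp [auxY, hk, Matrix.one_apply, Fin.ext_iff]
    · simp [auxY]
    · simp only [auxY, Matrix.submatrix_apply, finSumFinEquiv_apply_left, finSumFinEquiv_apply_right,
        id, Matrix.of_apply, Fin.addCases_left, Matrix.fromBlocks_apply₂₁, Matrix.zero_apply]
      rw [if_neg]
      rw [← hk c]
      intro hh
      have := hf.injective (Fin.ext hh)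
      rw [Fin.ext_iff] at this
      simp at this
      omega
    · simp [auxY]
  rw [e, Matrix.det_fromBlocks_zero₂₁, Matrix.det_one, one_mul]
  have e2 := (starRingEnd ℂ).map_det (Matrix.of fun r t : Fin a =>
    g (f (Fin.natAdd k r)) (Fin.castLE (by omega) t))
  have := pos_conj (leftMinor_pos g hg (by omega) (fun r : Fin a => f (Fin.natAdd k r))
    (hf.comp (Fin.strictMono_natAdd k)))
  rw [← starRingEnd_apply, e2] at this
  exact this

theorem auxY_det_zero {n : ℕ} (g : Matrix (Fin n) (Fin n) ℂ) (k a : ℕ) (h : k + a ≤ n)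
    (f : Fin (k + a) → Fin n) (hf : StrictMono f)
    (hk : ¬ ∀ c : Fin k, (f (Fin.castAdd a c) : ℕ) = c) :
    ((auxY g k a h).submatrix f id).det = 0 := by
  by_contra hne
  apply hk
  have hr : ∀ c : Fin k, ∃ t, (f t : ℕ) = c := by
    intro c
    by_contra! hc
    apply hne
    apply Matrix.det_eq_zero_of_column_eq_zero (Fin.castAdd a c)
    intro t
    simp [auxY, hc]
  have hle : ∀ N (t : Fin (k + a)), (t : ℕ) = N → N ≤ (f t : ℕ) := by
    intro N
    induction N with
    | zero => intros; omega
    | succ N ih =>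
      intro t ht
      have h1 := ih ⟨N, by omega⟩ rfl
      have h2 : f ⟨N, by omega⟩ < f t := hf (by simp [Fin.lt_def, ht])
      rw [Fin.lt_def] at h2
      omega
  have : ∀ N (hN : N < k), (f ⟨N, by omega⟩ : ℕ) = N := by
    intro N
    induction N using Nat.strong_induction_on with
    | _ N ih =>
      intro hN
      obtain ⟨t, ht⟩ := hr ⟨N, hN⟩
      have h1 := hle _ t rfl
      simp only at ht
      rcases Nat.lt_or_ge t N with h2 | h2
      · have := ih t h2 (by omega)
        simp only [Fin.eta] at this
        omega
      · have : t = ⟨N, by omega⟩ := Fin.ext (by simp; omega)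
        rw [← this, ht]
  intro c
  exact this c c.2

theorem term_sorted {n : ℕ} (g : Matrix (Fin n) (Fin n) ℂ)
    (hg : ∀ I : Finset (Fin n), IsPosReal (leftMinor g I)) (k a : ℕ) (h : k + a ≤ n)
    (f : Fin (k + a) → Fin n) (hf : StrictMono f) :
    IsNonnegReal (((auxY g k a h).submatrix f id).det * ((auxX g k a h).submatrix f id).det) := by
  by_cases hk : ∀ c : Fin k, (f (Fin.castAdd a c) : ℕ) = c
  · have := pos_mul (auxY_det_pos g hg k a h f hf hk) (leftMinor_pos g hg h f hf)
    exact ⟨this.1.le, this.2⟩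
  · rw [auxY_det_zero g k a h f hf hk, zero_mul]
    simp [IsNonnegReal]

theorem term_nonneg {n : ℕ} (g : Matrix (Fin n) (Fin n) ℂ)
    (hg : ∀ I : Finset (Fin n), IsPosReal (leftMinor g I)) (k a : ℕ) (h : k + a ≤ n)
    (f : Fin (k + a) → Fin n) :
    IsNonnegReal (((auxY g k a h).submatrix f id).det * ((auxX g k a h).submatrix f id).det) := by
  by_cases hf : Function.Injective f
  · have hs : StrictMono (f ∘ Tuple.sort f) :=
      (Tuple.monotone_sort f).strictMono_of_injective (hf.comp (Tuple.sort f).injective)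
    have := term_sorted g hg k a h _ hs
    have e1 := Matrix.det_permute (Tuple.sort f) ((auxY g k a h).submatrix f id)
    have e2 := Matrix.det_permute (Tuple.sort f) ((auxX g k a h).submatrix f id)
    rw [Matrix.submatrix_submatrix] at e1 e2
    change Matrix.det ((auxY g k a h).submatrix (f ∘ Tuple.sort f) id) = _ at e1
    change Matrix.det ((auxX g k a h).submatrix (f ∘ Tuple.sort f) id) = _ at e2
    rw [e1, e2] at this
    have s : ((Equiv.Perm.sign (Tuple.sort f) : ℤ) : ℂ) * ((Equiv.Perm.sign (Tuple.sort f) : ℤ) : ℂ) = 1 := by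
      rw [← Int.cast_mul, ← Units.val_mul, Int.units_mul_self]; simp
    rw [mul_mul_mul_comm, s, one_mul] at this
    exact this
  · simp only [Function.Injective] at hf
    push Not at hf
    obtain ⟨i, j, hij, hne⟩ := hf
    rw [Matrix.det_zero_of_row_eq hne (M := (auxX g k a h).submatrix f id)
      (by ext c; simp [hij]), mul_zero]
    simp [IsNonnegReal]

theorem aux_pos {n : ℕ} (g : Matrix (Fin n) (Fin n) ℂ)
    (hg : ∀ I : Finset (Fin n), IsPosReal (leftMinor g I)) (k a : ℕ) (h : k + a ≤ n) :
    IsPosReal ((auxY g k a h)ᵀ * auxX g k a h).det := by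
  have hfac : IsPosReal ((k + a).factorial : ℂ) := by
    rw [pos_iff]
    exact ⟨((k + a).factorial : ℝ), by exact_mod_cast Nat.factorial_pos _, by simp⟩
  apply pos_cancel hfac
  rw [cauchy_binet]
  have hn := term_nonneg g hg k a h
  refine ⟨?_, ?_⟩
  · rw [Complex.re_sum]
    refine Finset.sum_pos' (fun f _ => (hn f).1) ⟨Fin.castLE h, Finset.mem_univ _, ?_⟩
    exact (pos_mul (auxY_det_pos g hg k a h _ (Fin.strictMono_castLE h) (by simp))
      (leftMinor_pos g hg h _ (Fin.strictMono_castLE h))).1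
  · rw [Complex.im_sum]
    exact Finset.sum_eq_zero fun f _ => (hn f).2

theorem aux_det {n : ℕ} (g : Matrix (Fin n) (Fin n) ℂ) (hu : g.conjTranspose * g = 1)
    (k a : ℕ) (h : k + a ≤ n) :
    ((auxY g k a h)ᵀ * auxX g k a h).det = (-1) ^ (a * k) *
      Matrix.det (Matrix.of fun r c : Fin k =>
        g (Fin.castLE (by omega) r) ⟨a + c, by omega⟩) := by
  obtain ⟨ρ, h1, h2, h3⟩ := exists_rot k a
  have hp := Matrix.det_permute' ρ ((auxY g k a h)ᵀ * auxX g k a h)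
  rw [h3] at hp
  have s : ((-1 : ℂ) ^ (a * k)) * (-1) ^ (a * k) = 1 := by
    rw [← pow_add, ← two_mul, pow_mul]; simp
  have : ((auxY g k a h)ᵀ * auxX g k a h).det = (-1) ^ (a * k) *
      (((auxY g k a h)ᵀ * auxX g k a h).submatrix id ρ).det := by
    rw [hp, ← mul_assoc, s, one_mul]
  rw [this]
  congr 1
  rw [← Matrix.det_submatrix_equiv_self (finSumFinEquiv (m := k) (n := a))]
  have top : ∀ (r : Fin k) (c : Fin (k + a)), ((auxY g k a h)ᵀ * auxX g k a h) (Fin.castAdd a r) c =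
      g (Fin.castLE (by omega) r) (Fin.castLE h c) := by
    intro r c
    rw [Matrix.mul_apply, Finset.sum_eq_single (Fin.castLE (by omega) r)]
    · simp [auxY, auxX]
    · intro b _ hb
      have : (b : ℕ) ≠ r := fun hh => hb (Fin.ext hh)
      simp [auxY, this]
    · simp
  have bot : ∀ (r : Fin a) (c : Fin (k + a)), ((auxY g k a h)ᵀ * auxX g k a h) (Fin.natAdd k r) c =
      if (r : ℕ) = c then 1 else 0 := by
    intro r c
    have := congrFun (congrFun hu (Fin.castLE (by omega) r)) (Fin.castLE h c)
    rw [Matrix.mul_apply, Matrix.one_apply] at this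
    simp only [Fin.ext_iff, Fin.val_castLE] at this
    rw [← this, Matrix.mul_apply]
    simp [auxY, auxX, Matrix.conjTranspose_apply]
  have e : (((auxY g k a h)ᵀ * auxX g k a h).submatrix id ρ).submatrix
      (finSumFinEquiv (m := k) (n := a)) (finSumFinEquiv (m := k) (n := a)) =
      Matrix.fromBlocks (Matrix.of fun r c : Fin k =>
        g (Fin.castLE (by omega) r) ⟨a + c, by omega⟩)
        (Matrix.of fun r c => g (Fin.castLE (by omega) r) (Fin.castLE (by omega) c)) 0 1 := by
    ext (r | r) (c | c)
    · simp only [Matrix.submatrix_apply, finSumFinEquiv_apply_left, id, top, Matrix.fromBlocks_apply₁₁,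
        Matrix.of_apply]
      congr 1
      exact Fin.ext (h1 c)
    · simp only [Matrix.submatrix_apply, finSumFinEquiv_apply_left, finSumFinEquiv_apply_right, id, top,
        Matrix.fromBlocks_apply₁₂, Matrix.of_apply]
      congr 1
      exact Fin.ext (h2 c)
    · simp only [Matrix.submatrix_apply, finSumFinEquiv_apply_left, finSumFinEquiv_apply_right, id, bot,
        Matrix.fromBlocks_apply₂₁, Matrix.zero_apply, h1]
      rw [if_neg (by omega)]
    · simp only [Matrix.submatrix_apply, finSumFinEquiv_apply_right, id, bot,
        Matrix.fromBlocks_apply₂₂, Matrix.one_apply, h2, Fin.ext_iff]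
  rw [e, Matrix.det_fromBlocks_zero₂₁, Matrix.det_one, mul_one]

/-- The twist, with the inverse replaced by the adjoint. -/
noncomputable def twist {n : ℕ} (g : Matrix (Fin n) (Fin n) ℂ) : Matrix (Fin n) (Fin n) ℂ :=
  deltaMat n * g.conjTranspose * deltaMat n

theorem twist_apply {n : ℕ} (g : Matrix (Fin n) (Fin n) ℂ) (r c : Fin n) :
    twist g r c = (-1) ^ (r : ℕ) * ((-1) ^ (c : ℕ) * star (g c r)) := by
  rw [twist, deltaMat, Matrix.mul_diagonal, Matrix.diagonal_mul, Matrix.conjTranspose_apply]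
  ring

theorem delta_sq (n : ℕ) : deltaMat n * deltaMat n = 1 := by
  rw [deltaMat, Matrix.diagonal_mul_diagonal, ← Matrix.diagonal_one]
  congr 1
  ext i
  rw [← pow_add, ← two_mul, pow_mul]; simp

theorem delta_star (n : ℕ) : (deltaMat n).conjTranspose = deltaMat n := by
  rw [deltaMat, Matrix.diagonal_conjTranspose]
  congr 1
  ext i
  simp

theorem twist_unitary {n : ℕ} (g : Matrix (Fin n) (Fin n) ℂ) (hu : g.conjTranspose * g = 1) :
    (twist g).conjTranspose * twist g = 1 := by
  have hu' : g * g.conjTranspose = 1 := mul_eq_one_comm.1 hu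
  simp only [twist, Matrix.conjTranspose_mul, delta_star, Matrix.conjTranspose_conjTranspose]
  calc deltaMat n * (g * deltaMat n) * (deltaMat n * g.conjTranspose * deltaMat n)
      = deltaMat n * (g * (deltaMat n * deltaMat n) * g.conjTranspose) * deltaMat n := by
        simp only [Matrix.mul_assoc]
    _ = 1 := by rw [delta_sq, Matrix.mul_one, hu', Matrix.mul_one, delta_sq]

theorem twist_interval {n : ℕ} (g : Matrix (Fin n) (Fin n) ℂ) (hg : g ∈ UnitaryTP n)
    (k a : ℕ) (h : k + a ≤ n) :
    IsPosReal (Matrix.det (Matrix.of fun r c : Fin k =>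
      twist g ⟨a + r, by omega⟩ (Fin.castLE (by omega) c))) := by
  have hp := aux_pos g hg.2 k a h
  rw [aux_det g hg.1] at hp
  set G : Matrix (Fin k) (Fin k) ℂ := Matrix.of fun r c : Fin k =>
        g (Fin.castLE (by omega) r) ⟨a + c, by omega⟩ with hG
  have e : (Matrix.of fun r c : Fin k =>
      twist g ⟨a + r, by omega⟩ (Fin.castLE (by omega) c)) =
      Matrix.of fun r c : Fin k => (-1 : ℂ) ^ (a + r : ℕ) *
        (Matrix.of fun r c : Fin k => (-1 : ℂ) ^ (c : ℕ) * G.conjTranspose r c) r c := by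
    ext r c
    simp [twist_apply, hG]
  rw [e, Matrix.det_mul_column, Matrix.det_mul_row, Matrix.det_conjTranspose]
  have s : (∏ i : Fin k, (-1 : ℂ) ^ (i : ℕ)) * (∏ i : Fin k, (-1 : ℂ) ^ (i : ℕ)) = 1 := by
    rw [← Finset.prod_mul_distrib]
    refine Finset.prod_eq_one fun i _ => ?_
    rw [← pow_add, ← two_mul, pow_mul]; simp
  have e2 : (∏ i : Fin k, (-1 : ℂ) ^ (a + i : ℕ)) * ((∏ i : Fin k, (-1 : ℂ) ^ (i : ℕ)) * star G.det) =
      star ((-1) ^ (a * k) * G.det) := by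
    simp only [pow_add, Finset.prod_mul_distrib, Finset.prod_const, Finset.card_univ, Fintype.card_fin]
    rw [← pow_mul, mul_assoc, ← mul_assoc (∏ i : Fin k, (-1 : ℂ) ^ (i : ℕ)), s]
    simp
  rw [e2]
  exact pos_conj hp

theorem twist_TP {n : ℕ} (g : Matrix (Fin n) (Fin n) ℂ) (hg : g ∈ UnitaryTP n) :
    twist g ∈ UnitaryTP n := by
  refine ⟨twist_unitary g hg.1, fun I => ?_⟩
  have hI : I.card ≤ n := by simpa using I.card_le_univ
  rw [leftMinor_eq _ I rfl hI]
  let M : ℕ → ℕ → ℂ := fun r c => if hh : r < n ∧ c < n then twist g ⟨r, hh.1⟩ ⟨c, hh.2⟩ else 0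
  have hM : ∀ (r c : Fin n), M r c = twist g r c := by
    intro r c
    simp [M]
  have := fekete M n (by
    intro a k hak
    have := twist_interval g hg k a (by omega)
    have e : ldet M (fun r : Fin k => a + (r : ℕ)) = Matrix.det (Matrix.of fun r c : Fin k =>
        twist g ⟨a + r, by omega⟩ (Fin.castLE (by omega) c)) := by
      unfold ldet
      congr 1
      ext r c
      rw [Matrix.of_apply, Matrix.of_apply, ← hM]
      rfl
    rw [e]
    exact this) I.card n (fun r => (I.orderEmbOfFin rfl r : ℕ))
    (fun r s hrs => (I.orderEmbOfFin rfl).strictMono hrs) (fun r => Fin.is_lt _)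
    (fun r s => by have := (I.orderEmbOfFin rfl r).is_lt; omega)
  unfold ldet at this
  simp only [← hM]
  exact this

theorem inv_eq_star {n : ℕ} (g : Matrix (Fin n) (Fin n) ℂ) (hu : g.conjTranspose * g = 1) :
    deltaMat n * g⁻¹ * deltaMat n = twist g := by
  rw [Matrix.inv_eq_left_inv hu, twist]

/-- The involution `ι(g) = δ_n g⁻¹ δ_n` preserves `U_n^{>0}` (if every
left-justified minor of the unitary matrix `g` is a positive real, then the same holds
for `δ_n g⁻¹ δ_n`) and preserves `U_n^{≥0}`. -/
theorem twist_preserves_positivity {n : ℕ} (hn : 1 ≤ n) :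
    (∀ g : Matrix (Fin n) (Fin n) ℂ, g ∈ UnitaryTP n →
        deltaMat n * g⁻¹ * deltaMat n ∈ UnitaryTP n) ∧
    (∀ g : Matrix (Fin n) (Fin n) ℂ, g ∈ UnitaryTNN n →
        deltaMat n * g⁻¹ * deltaMat n ∈ UnitaryTNN n) := by
  refine ⟨fun g hg => ?_, fun g hg => ?_⟩
  · rw [inv_eq_star g hg.1]
    exact twist_TP g hg
  · have hu : g.conjTranspose * g = 1 := by
      have hcl : IsClosed {g : Matrix (Fin n) (Fin n) ℂ | g.conjTranspose * g = 1} :=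
        isClosed_eq ((continuous_id.matrix_conjTranspose).matrix_mul continuous_id) continuous_const
      exact closure_minimal (fun x hx => hx.1) hcl hg
    rw [inv_eq_star g hu]
    have hc : Continuous (twist : Matrix (Fin n) (Fin n) ℂ → _) := by
      exact (continuous_const.matrix_mul continuous_id.matrix_conjTranspose).matrix_mul
        continuous_const
    exact map_mem_closure hc hg (fun x hx => twist_TP x hx)
end

section
/- Let g be an n×n complex unitary matrix. Then there exist a real n×n matrix h all of whose minors Δ_{I,J}(h) (for all subsets I, J of equal cardinality, of every order from 1 to n) are positive, and an upper-triangular invertible complex n×n matrix T with positive real diagonal entries, such that h = g·T, if and only if every left-justified minor of g is a positive real number. -/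
open Matrix Finset

lemma minorOn_eq {R : Type} [CommRing R] {n k : ℕ} (g : Matrix (Fin n) (Fin n) R)
    (I J : Finset (Fin n)) (hI : I.card = k) (hJ : J.card = k) :
    minorOn g I J = (g.submatrix (I.orderEmbOfFin hI) (J.orderEmbOfFin hJ)).det := by
  subst hI
  simp only [minorOn, dif_pos hJ]
  rfl

lemma filter_lt_card {n k : ℕ} (hk : k ≤ n) :
    (Finset.univ.filter fun j : Fin n => (j : ℕ) < k).card = k := by
  have : (Finset.univ.filter fun j : Fin n => (j : ℕ) < k)
      = Finset.univ.image (Fin.castLE hk) := by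
    ext j
    simp only [Finset.mem_filter, Finset.mem_univ, true_and, Finset.mem_image]
    constructor
    · intro h
      exact ⟨⟨j, h⟩, rfl⟩
    · rintro ⟨a, rfl⟩
      exact a.2
  rw [this, Finset.card_image_of_injective _ (Fin.castLE_injective hk)]
  simp

lemma leftMinor_eq_s3 {R : Type} [CommRing R] {n k : ℕ} (g : Matrix (Fin n) (Fin n) R)
    (I : Finset (Fin n)) (hI : I.card = k) (hk : k ≤ n) (e : Fin k → Fin n)
    (he : StrictMono e) (heI : ∀ a, e a ∈ I) :
    leftMinor g I = (g.submatrix e (Fin.castLE hk)).det := by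
  subst hI
  rw [leftMinor, minorOn_eq g I _ rfl (filter_lt_card hk)]
  rw [← Finset.orderEmbOfFin_unique rfl heI he]
  rw [← Finset.orderEmbOfFin_unique (f := Fin.castLE hk) (filter_lt_card hk) (by simp) 
    (Fin.strictMono_castLE hk)]

lemma leftMinor_strictMono {R : Type} [CommRing R] {n k : ℕ} (g : Matrix (Fin n) (Fin n) R)
    (hk : k ≤ n) (e : Fin k → Fin n) (he : StrictMono e) :
    leftMinor g (Finset.univ.image e) = (g.submatrix e (Fin.castLE hk)).det :=
  leftMinor_eq_s3 g _ (by rw [Finset.card_image_of_injective _ he.injective]; simp) hk e he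
    (by simp)

/-- Right multiplication by an upper triangular matrix. -/
lemma det_mul_upper {n k : ℕ} (hk : k ≤ n) (g T : Matrix (Fin n) (Fin n) ℂ)
    (e : Fin k → Fin n) (hT : ∀ i j : Fin n, j < i → T i j = 0) :
    ((g * T).submatrix e (Fin.castLE hk)).det =
      (g.submatrix e (Fin.castLE hk)).det * ∏ i : Fin k, T (Fin.castLE hk i) (Fin.castLE hk i) := by
  have h1 : (g * T).submatrix e (Fin.castLE hk) =
      g.submatrix e (Fin.castLE hk) * T.submatrix (Fin.castLE hk) (Fin.castLE hk) := by
    ext a b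
    simp only [Matrix.submatrix_apply, Matrix.mul_apply]
    symm
    apply Finset.sum_of_injOn (Fin.castLE hk) (Fin.castLE_injective hk).injOn (by simp)
    · intro c _ hc
      rw [hT c _ _, mul_zero]
      by_contra hlt
      apply hc
      simp only [Finset.coe_univ, Set.image_univ, Set.mem_range]
      have : (c : ℕ) ≤ b := by simpa [Fin.lt_def] using hlt
      exact ⟨⟨c, by omega⟩, rfl⟩
    · intros; rfl
  rw [h1, Matrix.det_mul]
  congr 1
  rw [Matrix.det_of_isUpperTriangular]
  · rfl
  · intro a b hab
    exact hT _ _ (Fin.strictMono_castLE hk hab)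

lemma IsPosReal.iff_exists (z : ℂ) : IsPosReal z ↔ ∃ r : ℝ, 0 < r ∧ z = r := by
  constructor
  · rintro ⟨h1, h2⟩
    exact ⟨z.re, h1, by apply Complex.ext <;> simp [h2]⟩
  · rintro ⟨r, h, rfl⟩
    exact ⟨by simpa, by simp⟩

lemma forward {n : ℕ} (g : Matrix (Fin n) (Fin n) ℂ) (h : Matrix (Fin n) (Fin n) ℝ)
    (T : Matrix (Fin n) (Fin n) ℂ)
    (hh : ∀ I J : Finset (Fin n), I.Nonempty → I.card = J.card → 0 < minorOn h I J)
    (hT : ∀ i j : Fin n, j < i → T i j = 0)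
    (hd : ∀ i : Fin n, IsPosReal (T i i))
    (hm : h.map (Complex.ofReal) = g * T) (I : Finset (Fin n)) : IsPosReal (leftMinor g I) := by
  have hk : I.card ≤ n := by simpa using Finset.card_le_univ I
  have key := det_mul_upper hk g T (I.orderEmbOfFin rfl) hT
  have hl : ∀ {R : Type} [CommRing R] (m : Matrix (Fin n) (Fin n) R), leftMinor m I = _ :=
    fun m => leftMinor_eq_s3 m I rfl hk (I.orderEmbOfFin rfl)
    (I.orderEmbOfFin rfl).strictMono (by simp)
  rw [← hm, ← hl] at key
  rw [← hl] at key
  have hpos : 0 < leftMinor h I := by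
    rcases I.eq_empty_or_nonempty with rfl | hne
    · rw [hl h, Matrix.det_eq_one_of_card_eq_zero]
      · exact one_pos
      · exact (Fintype.card_fin _).trans Finset.card_empty
    · exact hh _ _ hne (filter_lt_card hk).symm
  have hc : leftMinor (h.map Complex.ofReal) I = ((leftMinor h I : ℝ) : ℂ) := by
    rw [hl, hl h]
    exact (RingHom.map_det Complex.ofRealHom _).symm
  choose t ht htT using fun i => (IsPosReal.iff_exists _).1 (hd i)
  rw [hc] at key
  simp only [htT] at key
  rw [← Complex.ofReal_prod] at key
  have hp : 0 < ∏ i : Fin I.card, t (Fin.castLE hk i) := Finset.prod_pos fun i _ => ht _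
  rw [IsPosReal.iff_exists]
  refine ⟨_, div_pos hpos hp, ?_⟩
  rw [Complex.ofReal_div, key, mul_div_cancel_right₀]
  exact_mod_cast (ne_of_gt hp)

/-- Unitarity plus reality of left minors forces the matrix to be real. -/
lemma real_of_pos {n : ℕ} (g : Matrix (Fin n) (Fin n) ℂ)
    (hg : g.conjTranspose * g = 1) (hpos : ∀ I : Finset (Fin n), IsPosReal (leftMinor g I)) :
    ∀ j i, star (g i j) = g i j := by
  have hdet : ∀ {k : ℕ} (hk : k ≤ n) (e : Fin k → Fin n), StrictMono e →
      ∃ r : ℝ, 0 < r ∧ (g.submatrix e (Fin.castLE hk)).det = r := by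
    intro k hk e he
    rw [← leftMinor_strictMono g hk e he, ← IsPosReal.iff_exists]
    exact hpos _
  rintro ⟨k, hkn⟩
  induction k using Nat.strong_induction_on with
  | _ k ih =>
  have hk : k ≤ n := hkn.le
  set K : Fin n := ⟨k, hkn⟩ with hK
  set A : Matrix (Fin k) (Fin k) ℂ := g.submatrix (Fin.castLE hk) (Fin.castLE hk) with hA
  have ih' : ∀ i (a : Fin k), star (g i (Fin.castLE hk a)) = g i (Fin.castLE hk a) :=
    fun i a => ih a a.2 _ i
  obtain ⟨r, hr, hAr⟩ := hdet hk (Fin.castLE hk) (Fin.strictMono_castLE hk)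
  have hAu : IsUnit A.det := by
    rw [isUnit_iff_ne_zero, hA, hAr]; exact_mod_cast hr.ne'
  have hAs : A.map star = A := by ext a b; exact ih' _ _
  have hAis : ∀ a b, star (A⁻¹ a b) = A⁻¹ a b := by
    intro a b
    have h1 : (A⁻¹).map star = A⁻¹ := by
      symm
      apply Matrix.inv_eq_left_inv
      have : (A⁻¹ * A).map (starRingEnd ℂ) = (1 : Matrix (Fin k) (Fin k) ℂ).map (starRingEnd ℂ) := by
        rw [Matrix.nonsing_inv_mul A hAu]
      rw [Matrix.map_mul] at this
      change A⁻¹.map star * A.map star = _ at this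
      rw [hAs] at this
      rw [this]
      ext a b
      by_cases h : a = b <;> simp [Matrix.one_apply, h]
    exact congrFun (congrFun h1 a) b
  -- the Schur complement is real
  have hs : ∀ i : Fin n, star (g i K - ∑ a, ∑ b, g i (Fin.castLE hk a) * A⁻¹ a b * g (Fin.castLE hk b) K)
      = g i K - ∑ a, ∑ b, g i (Fin.castLE hk a) * A⁻¹ a b * g (Fin.castLE hk b) K := by
    intro i
    by_cases hik : (i : ℕ) < k
    · have h0 : ∑ a, ∑ b, g i (Fin.castLE hk a) * A⁻¹ a b * g (Fin.castLE hk b) K = g i K := by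
        have h1 := congrFun (congrArg (fun M => M.mulVec (fun b => g (Fin.castLE hk b) K))
          (Matrix.mul_nonsing_inv A hAu)) ⟨i, hik⟩
        simp only [Matrix.one_mulVec] at h1
        rw [Finset.sum_comm]
        simp only [Matrix.mulVec, dotProduct, Matrix.mul_apply, Finset.sum_mul] at h1
        exact h1
      rw [h0]; simp
    · have hemono : StrictMono (Fin.snoc (α := fun _ => Fin n) (Fin.castLE hk) i : Fin (k+1) → Fin n) := by
        intro a b hab
        induction b using Fin.lastCases with
        | last =>
          induction a using Fin.lastCases with
          | last => exact absurd hab (lt_irrefl _)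
          | cast a => 
            simp only [Fin.snoc_castSucc, Fin.snoc_last, Fin.lt_def, Fin.val_castLE]
            omega
        | cast b =>
          induction a using Fin.lastCases with
          | last => simp [Fin.lt_def] at hab; omega
          | cast a =>
            simp only [Fin.snoc_castSucc]
            exact Fin.strictMono_castLE hk (Fin.castSucc_lt_castSucc_iff.1 hab)
      obtain ⟨s, hs, hdets⟩ := hdet (Nat.succ_le_of_lt hkn) _ hemono
      have hblock : (g.submatrix (Fin.snoc (α := fun _ => Fin n) (Fin.castLE hk) i : Fin (k+1) → Fin n)
          (Fin.castLE (Nat.succ_le_of_lt hkn))).submatrix finSumFinEquiv finSumFinEquiv = 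
          Matrix.fromBlocks A (Matrix.of fun b (_ : Fin 1) => g (Fin.castLE hk b) K)
            (Matrix.of fun (_ : Fin 1) a => g i (Fin.castLE hk a)) 
            (Matrix.of fun (_ _ : Fin 1) => g i K) := by
        have e1 : ∀ a : Fin k, (Fin.snoc (α := fun _ => Fin n) (Fin.castLE hk) i : Fin (k+1) → Fin n) 
            (Fin.castAdd 1 a) = Fin.castLE hk a := fun a => Fin.snoc_castSucc (α := fun _ => Fin n) i (Fin.castLE hk) a
        have e2 : ∀ a : Fin 1, (Fin.snoc (α := fun _ => Fin n) (Fin.castLE hk) i : Fin (k+1) → Fin n) 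
            (Fin.natAdd k a) = i := by
          intro a
          obtain rfl : a = 0 := Subsingleton.elim _ _
          exact Fin.snoc_last (α := fun _ => Fin n) i (Fin.castLE hk)
        have e3 : ∀ a : Fin 1, Fin.castLE (Nat.succ_le_of_lt hkn) (Fin.natAdd k a) = K := by
          intro a
          obtain rfl : a = 0 := Subsingleton.elim _ _
          rfl
        ext a b
        rcases a with a | a <;> rcases b with b | b <;>
          simp only [Matrix.submatrix_apply, finSumFinEquiv_apply_left, finSumFinEquiv_apply_right,
            Matrix.fromBlocks_apply₁₁, Matrix.fromBlocks_apply₁₂, Matrix.fromBlocks_apply₂₁,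
            Matrix.fromBlocks_apply₂₂, e1, e2, e3, Matrix.of_apply, hA] <;> rfl
      have hd2 := congrArg Matrix.det hblock
      let _ := Matrix.invertibleOfIsUnitDet A hAu
      rw [Matrix.det_submatrix_equiv_self, hdets, Matrix.det_fromBlocks₁₁,
        show A.det = (r : ℂ) from hAr] at hd2
      simp only [Matrix.det_fin_one, Matrix.sub_apply, Matrix.of_apply, Matrix.mul_apply,
        Matrix.invOf_eq_nonsing_inv, Finset.sum_mul] at hd2
      rw [Finset.sum_comm] at hd2
      have hr' : (r : ℂ) ≠ 0 := by exact_mod_cast hr.ne'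
      have : (g i K - ∑ a, ∑ b, g i (Fin.castLE hk a) * A⁻¹ a b * g (Fin.castLE hk b) K)
          = ((s / r : ℝ) : ℂ) := by
        rw [Complex.ofReal_div, hd2, mul_div_cancel_left₀ _ hr']
      rw [this]
      exact Complex.conj_ofReal _
  -- `y = x - conj x` is in the span of the previous columns
  set y : Fin n → ℂ := fun i => g i K - star (g i K) with hy
  have hy1 : ∀ i, y i = ∑ a, g i (Fin.castLE hk a) * ∑ b, A⁻¹ a b * y (Fin.castLE hk b) := by
    intro i
    have h1 := hs i
    simp only [star_sub, star_sum, star_mul', hAis, ih'] at h1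
    simp only [hy, mul_sub, Finset.mul_sum, Finset.sum_sub_distrib, ← mul_assoc]
    linear_combination -h1
  have hort : ∀ a : Fin k, ∑ i, g i (Fin.castLE hk a) * g i K = 0 := by
    intro a
    have h1 := congrFun (congrFun hg (Fin.castLE hk a)) K
    rw [Matrix.mul_apply, Matrix.one_apply_ne (by simp [Fin.ext_iff, hK]; omega)] at h1
    simpa only [Matrix.conjTranspose_apply, ih'] using h1
  have hort2 : ∀ a : Fin k, ∑ i, g i (Fin.castLE hk a) * star (y i) = 0 := by
    intro a
    have h2 := congrArg star (hort a)
    simp only [star_sum, star_mul', ih', star_zero] at h2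
    simp only [hy, star_sub, star_star, mul_sub, Finset.sum_sub_distrib, hort a, h2, sub_zero]
  have hyy : ∑ i, y i * star (y i) = 0 := by
    calc ∑ i, y i * star (y i) = ∑ i, ∑ a, (g i (Fin.castLE hk a) * star (y i)) *
          ∑ b, A⁻¹ a b * y (Fin.castLE hk b) := by
          refine Finset.sum_congr rfl fun i _ => ?_
          conv_lhs => rw [hy1 i]
          rw [← hy1 i, Finset.sum_congr rfl (fun a _ => mul_right_comm _ _ _), ← Finset.sum_mul, ← hy1 i]
      _ = 0 := by
          rw [Finset.sum_comm]
          refine Finset.sum_eq_zero fun a _ => ?_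
          rw [← Finset.sum_mul, hort2 a, zero_mul]
  have hy0 : y = 0 := by
    have h3 : ∑ i, Complex.normSq (y i) = 0 := by
      have h4 : ((∑ i, Complex.normSq (y i) : ℝ) : ℂ) = 0 := by
        rw [← hyy, Complex.ofReal_sum]
        exact Finset.sum_congr rfl fun i _ => (Complex.mul_conj _).symm
      exact_mod_cast h4
    rw [Finset.sum_eq_zero_iff_of_nonneg fun i _ => Complex.normSq_nonneg _] at h3
    funext i
    exact Complex.normSq_eq_zero.1 (h3 i (Finset.mem_univ i))
  intro i
  exact (sub_eq_zero.1 (congrFun hy0 i)).symm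

noncomputable def Pmat (n : ℕ) : Matrix (Fin n) (Fin n) ℝ :=
  Matrix.of fun i j => (((j : ℕ).descFactorial (i : ℕ) : ℕ) : ℝ)

lemma Pmat_det_pos {n k : ℕ} (hk : k ≤ n) (f : Fin k → Fin n) (hf : StrictMono f) :
    0 < ((Pmat n).submatrix (Fin.castLE hk) f).det := by
  have h1 : ((Pmat n).submatrix (Fin.castLE hk) f)ᵀ = 
      Matrix.of fun i j : Fin k => (descPochhammer ℝ (j : ℕ)).eval (((f i : Fin n) : ℕ) : ℝ) := by
    ext a b
    simp [Pmat, descPochhammer_eval_eq_descFactorial]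
  rw [← Matrix.det_transpose, h1, ← Matrix.det_eval_matrixOfPolynomials_eq_det_vandermonde
    (fun i => (((f i : Fin n) : ℕ) : ℝ)) (fun j : Fin k => descPochhammer ℝ (j : ℕ))
    (fun i => descPochhammer_natDegree ..) (fun i => monic_descPochhammer ..), Matrix.det_vandermonde]
  refine Finset.prod_pos fun i _ => Finset.prod_pos fun j hj => sub_pos.2 ?_
  exact_mod_cast hf (Finset.mem_Ioi.1 hj)

open Filter Topology in
lemma eventually_pos {n k : ℕ} (hk : k ≤ n) (g : Matrix (Fin n) (Fin n) ℝ) (e f : Fin k → Fin n)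
    (hf : StrictMono f) (hg : 0 < (g.submatrix e (Fin.castLE hk)).det) :
    ∀ᶠ ε : ℝ in 𝓝[>] 0, 0 < 
      ((g * (Matrix.diagonal (fun i : Fin n => ε ^ (i : ℕ)) * Pmat n)).submatrix e f).det := by
  set B1 := (Pmat n).submatrix (Fin.castLE hk) f with hB1
  have hB1pos : 0 < B1.det := Pmat_det_pos hk f hf
  have hB1u : IsUnit B1.det := isUnit_iff_ne_zero.2 hB1pos.ne'
  set N : Matrix (Fin n) (Fin k) ℝ := (Pmat n).submatrix id f * B1⁻¹ with hN
  have hNtop : ∀ a b : Fin k, N (Fin.castLE hk a) b = if a = b then 1 else 0 := by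
    intro a b
    have := congrFun (congrFun (Matrix.mul_nonsing_inv B1 hB1u) a) b
    rw [Matrix.one_apply] at this
    rw [← this]
    rfl
  have hNB : N * B1 = (Pmat n).submatrix id f := by
    rw [hN, Matrix.mul_assoc, Matrix.nonsing_inv_mul B1 hB1u, Matrix.mul_one]
  set M : ℝ → Matrix (Fin k) (Fin k) ℝ := fun ε => 
    Matrix.of fun a b => ∑ c : Fin n, g (e a) c * ε ^ ((c : ℕ) - (b : ℕ)) * N c b with hM
  have hM0 : M 0 = g.submatrix e (Fin.castLE hk) := by
    ext a b
    simp only [hM, Matrix.of_apply, Matrix.submatrix_apply]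
    rw [Finset.sum_eq_single (Fin.castLE hk b)]
    · simp [hNtop]
    · intro c _ hc
      by_cases hcb : (c : ℕ) ≤ b
      · have h1 : c = Fin.castLE hk ⟨c, by omega⟩ := rfl
        rw [h1, hNtop, if_neg, mul_zero]
        intro hcb'
        exact hc (by rw [← hcb']; rfl)
      · rw [zero_pow (by omega)]; simp
    · simp
  have hcont : Continuous fun ε => (M ε).det := by
    apply Continuous.matrix_det
    refine continuous_matrix fun a b => ?_
    simp only [hM, Matrix.of_apply]
    fun_prop
  have hev : ∀ᶠ ε in 𝓝[>] (0 : ℝ), 0 < (M ε).det := by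
    have : ∀ᶠ ε in 𝓝 (0 : ℝ), 0 < (M ε).det := 
      hcont.continuousAt.eventually (lt_mem_nhds (show 0 < (M 0).det by rw [hM0]; exact hg))
    exact this.filter_mono nhdsWithin_le_nhds
  filter_upwards [hev, self_mem_nhdsWithin] with ε hε hε0
  have hfac : (g * (Matrix.diagonal (fun i : Fin n => ε ^ (i : ℕ)) * Pmat n)).submatrix e f
      = M ε * Matrix.diagonal (fun b : Fin k => ε ^ (b : ℕ)) * B1 := by
    have h2 : M ε * Matrix.diagonal (fun b : Fin k => ε ^ (b : ℕ)) = 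
        (g * Matrix.diagonal (fun i : Fin n => ε ^ (i : ℕ))).submatrix e id * N := by
      ext a b
      rw [Matrix.mul_diagonal, Matrix.mul_apply]
      simp only [hM, Matrix.of_apply, Finset.sum_mul, Matrix.submatrix_apply, Matrix.mul_diagonal, id]
      refine Finset.sum_congr rfl fun c _ => ?_
      by_cases hcb : (b : ℕ) ≤ c
      · rw [← Nat.sub_add_cancel hcb, pow_add, Nat.add_sub_cancel]; ring
      · have h1 : c = Fin.castLE hk ⟨c, by omega⟩ := rfl
        have h3 : N c b = 0 := by
          rw [h1, hNtop, if_neg]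
          intro hcb'
          exact hcb (by rw [← hcb'])
        rw [h3]; simp
    rw [h2, Matrix.mul_assoc, hNB, ← Matrix.mul_assoc]
    rfl
  rw [hfac, Matrix.det_mul, Matrix.det_mul, Matrix.det_diagonal]
  have : 0 < ∏ i : Fin k, ε ^ (i : ℕ) := Finset.prod_pos fun i _ => pow_pos hε0 _
  positivity

open Filter Topology in
/-- A unitary matrix `g` is the unitary (Iwasawa/QR) factor of a real
totally positive matrix — i.e. there exist a real matrix `h` all of whose minors (of
every order `1,…,n`) are positive and an invertible upper-triangular complex matrix `T`
with positive real diagonal entries such that `h = g·T` — if and only if every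
left-justified minor of `g` is a positive real number. -/
theorem unitary_factor_of_totally_positive {n : ℕ} (g : Matrix (Fin n) (Fin n) ℂ)
    (hg : g.conjTranspose * g = 1) :
    (∃ (h : Matrix (Fin n) (Fin n) ℝ) (T : Matrix (Fin n) (Fin n) ℂ),
        (∀ I J : Finset (Fin n), I.Nonempty → I.card = J.card → 0 < minorOn h I J) ∧
        (∀ i j : Fin n, j < i → T i j = 0) ∧ IsUnit T ∧
        (∀ i : Fin n, IsPosReal (T i i)) ∧
        h.map (Complex.ofReal) = g * T) ↔
      ∀ I : Finset (Fin n), IsPosReal (leftMinor g I) := by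
  constructor
  · rintro ⟨h, T, hh, hT, -, hd, hm⟩ I
    exact forward g h T hh hT hd hm I
  intro hpos
  have hreal := real_of_pos g hg hpos
  set g' : Matrix (Fin n) (Fin n) ℝ := g.map Complex.re with hg'
  have hgg : g'.map Complex.ofReal = g := by
    ext i j
    exact Complex.conj_eq_iff_re.1 (hreal j i)
  have hdet : ∀ I : Finset (Fin n), ∀ hk : I.card ≤ n,
      0 < (g'.submatrix (I.orderEmbOfFin rfl) (Fin.castLE hk)).det := by
    intro I hk
    have h1 := hpos I
    rw [leftMinor_eq_s3 g I rfl hk (I.orderEmbOfFin rfl) (I.orderEmbOfFin rfl).strictMono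
      (by simp), ← hgg] at h1
    have h2 : ((g'.map Complex.ofReal).submatrix (I.orderEmbOfFin rfl) (Fin.castLE hk)).det
        = ((g'.submatrix (I.orderEmbOfFin rfl) (Fin.castLE hk)).det : ℂ) :=
      (RingHom.map_det Complex.ofRealHom _).symm
    rw [h2] at h1
    simpa using h1.1
  have hev : ∀ᶠ ε : ℝ in 𝓝[>] 0, ∀ I J : Finset (Fin n), I.card = J.card → 
      0 < minorOn (g' * (Matrix.diagonal (fun i : Fin n => ε ^ (i : ℕ)) * Pmat n)) I J := by
    rw [eventually_all]; intro I
    rw [eventually_all]; intro J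
    by_cases hIJ : I.card = J.card
    · have hk : I.card ≤ n := by simpa using Finset.card_le_univ I
      filter_upwards [eventually_pos hk g' (I.orderEmbOfFin rfl) (J.orderEmbOfFin hIJ.symm)
        (J.orderEmbOfFin hIJ.symm).strictMono (hdet I hk)] with ε hε _
      rw [minorOn_eq _ I J rfl hIJ.symm]
      exact hε
    · exact Eventually.of_forall fun ε h => absurd h hIJ
  obtain ⟨ε, hε, hε0⟩ := (hev.and self_mem_nhdsWithin).exists
  have hε0 : 0 < ε := hε0
  set T' := Matrix.diagonal (fun i : Fin n => ε ^ (i : ℕ)) * Pmat n with hT'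
  have hup : ∀ i j : Fin n, j < i → T' i j = 0 := by
    intro i j hij
    rw [hT', Matrix.diagonal_mul, Pmat, Matrix.of_apply, Nat.descFactorial_eq_zero_iff_lt.2 hij]
    simp
  have hdi : ∀ i : Fin n, 0 < T' i i := by
    intro i
    rw [hT', Matrix.diagonal_mul, Pmat, Matrix.of_apply, Nat.descFactorial_self]
    positivity
  have hup' : ∀ i j : Fin n, j < i → T'.map Complex.ofReal i j = 0 := by
    intro i j hij
    simp [hup i j hij]
  refine ⟨g' * T', T'.map Complex.ofReal, fun I J _ h => hε I J h, hup', ?_, ?_, ?_⟩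
  · rw [Matrix.isUnit_iff_isUnit_det, isUnit_iff_ne_zero, Matrix.det_of_isUpperTriangular
      (fun i j hij => hup' i j hij)]
    refine Finset.prod_ne_zero_iff.2 fun i _ => ?_
    simpa using (hdi i).ne'
  · intro i
    exact ⟨by simpa using hdi i, by simp⟩
  · conv_rhs => rw [← hgg]
    exact Matrix.map_mul (f := Complex.ofRealHom)
end

section
/- Let g be a real n×n matrix all of whose minors Δ_{I,J}(g) (for all subsets I, J of equal cardinality, of every order from 1 to n, including all entries and the determinant) are positive. Then g has n distinct positive real eigenvalues λ₁ > λ₂ > ⋯ > λₙ > 0; that is, its characteristic polynomial equals ∏_{i=1}^{n} (X − λᵢ) with λ₁ > ⋯ > λₙ > 0. Moreover, there exists an invertible real n×n matrix h such that h⁻¹ g h = diag(λ₁, …, λₙ) and every left-justified minor of h is positive. -/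
open Matrix Finset

/-- Half of the Cauchy-Binet formula, expanding columns. -/
theorem gk_det_mul_expand {k n : ℕ} (A : Matrix (Fin k) (Fin n) ℝ) (W : Matrix (Fin n) (Fin k) ℝ) :
    (A * W).det = ∑ p : Fin k → Fin n, (∏ b, W (p b) b) * (A.submatrix id p).det := by
  rw [← Matrix.det_transpose]
  have h1 : (A * W)ᵀ = fun b => ∑ l, W l b • Aᵀ l := by
    ext b a
    simp [Matrix.mul_apply, Finset.sum_apply, mul_comm]
  change (Matrix.detRowAlternating : (Fin k → ℝ) [⋀^Fin k]→ₗ[ℝ] ℝ).toMultilinearMap (A * W)ᵀ = _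
  rw [h1, MultilinearMap.map_sum]
  refine Finset.sum_congr rfl fun p _ => ?_
  rw [MultilinearMap.map_smul_univ, smul_eq_mul]
  congr 1
  rw [← Matrix.det_transpose]
  rfl

theorem gk_det_mul_expand' {k n : ℕ} (W : Matrix (Fin k) (Fin n) ℝ) (A : Matrix (Fin n) (Fin k) ℝ) :
    (W * A).det = ∑ p : Fin k → Fin n, (∏ b, W b (p b)) * (A.submatrix p id).det := by
  rw [← Matrix.det_transpose, Matrix.transpose_mul, gk_det_mul_expand]
  refine Finset.sum_congr rfl fun p _ => ?_
  rw [← Matrix.det_transpose (A.submatrix p id)]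
  rfl

theorem gk_det_diff {k : ℕ} (N : Matrix (Fin (k+1)) (Fin (k+1)) ℝ) (c : ℝ) (hN : ∀ a, N a 0 = c) :
    N.det = c * (Matrix.of fun a b : Fin k => N a.succ b.succ - N a.castSucc b.succ).det := by
  have h := Matrix.det_eq_of_forall_row_eq_smul_add_pred (A := N)
    (B := Matrix.of fun a b => Fin.cases (N 0 b) (fun a' => N a'.succ b - N a'.castSucc b) a)
    (fun _ => 1) (by intro j; simp) (by intro i j; simp)
  rw [h, Matrix.det_succ_column_zero, Fin.sum_univ_succ]
  simp [hN]
  left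
  congr 1

/-- Perron: a positive matrix has a positive eigenvector. -/
theorem gk_perron {n : ℕ} (A : Matrix (Fin (n+1)) (Fin (n+1)) ℝ) (hA : ∀ i j, 0 < A i j) :
    ∃ (r : ℝ) (u : Fin (n+1) → ℝ), 0 < r ∧ (∀ i, 0 < u i) ∧ ∀ i, ∑ j, A i j * u j = r * u i := by
  classical
  let R : ℝ := ∑ i, ∑ j, A i j
  let S : Set ((Fin (n+1) → ℝ) × ℝ) :=
    (stdSimplex ℝ (Fin (n+1)) ×ˢ Set.Icc 0 R) ∩ {p | ∀ i, p.2 * p.1 i ≤ ∑ j, A i j * p.1 j}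
  have hS : IsCompact S := by
    apply ((isCompact_stdSimplex ℝ (Fin (n+1))).prod isCompact_Icc).inter_right
    simp only [Set.ofPred_forall]
    refine isClosed_iInter fun i => isClosed_le (by fun_prop) (by fun_prop)
  have key : ∀ (x : Fin (n+1) → ℝ) (r : ℝ), (∀ i, 0 < x i) → 0 ≤ r →
      (∀ i, r * x i ≤ ∑ j, A i j * x j) → ∃ y, (y, r) ∈ S := by
    intro x r hx hr h
    have hs : 0 < ∑ j, x j := Finset.sum_pos (fun i _ => hx i) Finset.univ_nonempty
    have hy : ∀ i, r * (x i / ∑ j, x j) ≤ ∑ j, A i j * (x j / ∑ j, x j) := by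
      intro i
      have := div_le_div_of_nonneg_right (h i) hs.le
      simpa [Finset.sum_div, mul_div_assoc] using this
    have hy1 : ∑ i, x i / ∑ j, x j = 1 := by
      rw [← Finset.sum_div]; exact div_self hs.ne'
    have hy0 : ∀ i, 0 ≤ x i / ∑ j, x j := fun i => (div_pos (hx i) hs).le
    refine ⟨fun i => x i / ∑ j, x j, ⟨⟨⟨hy0, hy1⟩, hr, ?_⟩, hy⟩⟩
    calc r = ∑ i, r * (x i / ∑ j, x j) := by rw [← Finset.mul_sum, hy1, mul_one]
      _ ≤ ∑ i, ∑ j, A i j * (x j / ∑ j, x j) := Finset.sum_le_sum fun i _ => hy i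
      _ ≤ ∑ i, ∑ j, A i j := by
        refine Finset.sum_le_sum fun i _ => Finset.sum_le_sum fun j _ => ?_
        refine mul_le_of_le_one_right (hA i j).le ?_
        rw [← hy1]
        exact Finset.single_le_sum (f := fun i => x i / ∑ j, x j) (fun i _ => hy0 i) (Finset.mem_univ j)
  have key2 : ∀ (x : Fin (n+1) → ℝ) (r : ℝ), (∀ i, 0 < x i) → 0 ≤ r →
      (∀ i, r * x i < ∑ j, A i j * x j) → ∃ y, ∃ r' > r, (y, r') ∈ S := by
    intro x r hx hr h
    obtain ⟨i0, -, hi0⟩ := Finset.exists_min_image Finset.univ (fun i => (∑ j, A i j * x j) / x i)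
      Finset.univ_nonempty
    have hlt : r < (∑ j, A i0 j * x j) / x i0 := by rw [lt_div_iff₀ (hx i0)]; exact h i0
    obtain ⟨y, hy⟩ := key x _ hx (hr.trans hlt.le) (fun i => by
      have := hi0 i (Finset.mem_univ i)
      rwa [le_div_iff₀ (hx i)] at this)
    exact ⟨y, _, hlt, hy⟩
  obtain ⟨y0, r0, hr0, hy0⟩ := key2 (fun _ => 1) 0 (fun _ => one_pos) le_rfl (fun i => by
    simp only [zero_mul, mul_one]
    exact Finset.sum_pos (fun j _ => hA i j) Finset.univ_nonempty)
  obtain ⟨⟨u, r⟩, hur, hmax⟩ := hS.exists_isMaxOn ⟨_, hy0⟩ (f := Prod.snd) (by fun_prop)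
  have hrpos : 0 < r := lt_of_lt_of_le hr0 (hmax hy0)
  obtain ⟨⟨⟨hu0, hu1⟩, -⟩, hur⟩ := hur
  simp only [Set.mem_ofPred_eq] at hu0 hu1 hur
  have hpos : ∀ x : Fin (n+1) → ℝ, (∀ i, 0 ≤ x i) → (∃ i, 0 < x i) → ∀ i, 0 < ∑ j, A i j * x j := by
    intro x hx ⟨j, hj⟩ i
    exact Finset.sum_pos' (fun l _ => mul_nonneg (hA i l).le (hx l)) ⟨j, Finset.mem_univ j, mul_pos (hA i j) hj⟩
  have hune : ∃ i, 0 < u i := by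
    by_contra hcon
    push Not at hcon
    have : ∑ i, u i ≤ 0 := Finset.sum_nonpos fun i _ => hcon i
    linarith
  have heq : ∀ i, ∑ j, A i j * u j = r * u i := by
    by_contra hcon
    push Not at hcon
    obtain ⟨i, hi⟩ := hcon
    have hlt : r * u i < ∑ j, A i j * u j := lt_of_le_of_ne (hur i) (Ne.symm hi)
    obtain ⟨y, r', hr', hy⟩ := key2 (fun i => ∑ j, A i j * u j) r (hpos u hu0 hune) hrpos.le (by
      intro i'
      have := hpos (fun i => (∑ j, A i j * u j) - r * u i) (fun i => sub_nonneg.2 (hur i))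
        ⟨i, sub_pos.2 hlt⟩ i'
      simp only [mul_sub, Finset.sum_sub_distrib] at this
      have e : ∑ j, A i' j * (r * u j) = r * ∑ j, A i' j * u j := by
        rw [Finset.mul_sum]; exact Finset.sum_congr rfl fun j _ => by ring
      linarith)
    exact absurd (hmax hy) (not_le.2 hr')
  refine ⟨r, u, hrpos, fun i => ?_, heq⟩
  have := hpos u hu0 hune i
  rw [heq] at this
  exact pos_of_mul_pos_right this hrpos.le

/-- Positivity of all minors with consecutive rows. -/
def GKRow {n : ℕ} (A : Matrix (Fin n) (Fin n) ℝ) : Prop :=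
  ∀ (k i : ℕ) (r f : Fin k → Fin n), (∀ a, (r a : ℕ) = i + a) → StrictMono f →
    0 < (A.submatrix r f).det

/-- The deflated matrix on differences. -/
def gkB {n : ℕ} (C : Matrix (Fin (n+1)) (Fin (n+1)) ℝ) : Matrix (Fin n) (Fin n) ℝ :=
  Matrix.of fun i j => ∑ l, if j.castSucc < l then (C i.succ l - C i.castSucc l) else 0

theorem gk_telescope {n : ℕ} (y : Fin (n+1) → ℝ) (s t : Fin (n+1)) (hst : s ≤ t) :
    y t - y s = ∑ j : Fin n, if s ≤ j.castSucc ∧ j.castSucc < t then y j.succ - y j.castSucc else 0 := by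
  induction t using Fin.induction with
  | zero =>
    have : s = 0 := by simpa using hst
    subst this
    simp
  | succ t ih =>
    rcases hst.lt_or_eq with h | h
    · have h' : s ≤ t.castSucc := Fin.le_castSucc_iff.2 h
      have e : y t.succ - y s = (y t.succ - y t.castSucc) + (y t.castSucc - y s) := by ring
      have e2 : y t.succ - y t.castSucc
          = ∑ j : Fin n, if j = t then y j.succ - y j.castSucc else 0 := by simp
      rw [e, ih h', e2, ← Finset.sum_add_distrib]
      refine Finset.sum_congr rfl fun j _ => ?_
      by_cases hj : j = t
      · subst hj; simp [h']
      · have h2 : (j : ℕ) ≠ t := fun h => hj (Fin.ext h)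
        have : (j.castSucc < t.succ) ↔ (j.castSucc < t.castSucc) := by
          simp only [Fin.lt_def, Fin.val_castSucc, Fin.val_succ]; omega
        simp [hj, this]
    · subst h
      rw [sub_self, eq_comm]
      refine Finset.sum_eq_zero fun j _ => ?_
      rw [if_neg]
      rintro ⟨h1, h2⟩
      exact absurd h1 (not_le.2 h2)

theorem gk_intertwine {n : ℕ} (C : Matrix (Fin (n+1)) (Fin (n+1)) ℝ) (c : ℝ)
    (hC : ∀ i, ∑ j, C i j = c) (y : Fin (n+1) → ℝ) (i : Fin n) :
    ∑ l, C i.succ l * y l - ∑ l, C i.castSucc l * y l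
      = ∑ j, gkB C i j * (y j.succ - y j.castSucc) := by
  have h1 : ∀ l, y l = y 0 + ∑ j : Fin n, if j.castSucc < l then y j.succ - y j.castSucc else 0 := by
    intro l
    have := gk_telescope y 0 l (Fin.zero_le _)
    simp only [Fin.zero_le, true_and] at this
    linarith
  have h2 : ∑ l, C i.succ l * y l - ∑ l, C i.castSucc l * y l
      = ∑ l, (C i.succ l - C i.castSucc l) * y 0
        + ∑ l, (C i.succ l - C i.castSucc l) *
          ∑ j : Fin n, if j.castSucc < l then y j.succ - y j.castSucc else 0 := by
    rw [← Finset.sum_add_distrib, ← Finset.sum_sub_distrib]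
    refine Finset.sum_congr rfl fun l _ => ?_
    rw [← mul_add, ← h1 l]; ring
  rw [h2, ← Finset.sum_mul, Finset.sum_sub_distrib, hC, hC, sub_self, zero_mul, zero_add]
  simp only [Finset.mul_sum, gkB, Matrix.of_apply, Finset.sum_mul]
  rw [Finset.sum_comm]
  refine Finset.sum_congr rfl fun j _ => Finset.sum_congr rfl fun l _ => ?_
  split_ifs <;> simp

/-- The block index. -/
def gkBeta {n k : ℕ} (f : Fin k → Fin n) (l : Fin (n+1)) : ℕ :=
  (Finset.univ.filter fun b => (f b).castSucc < l).card

theorem gkBeta_mono {n k : ℕ} (f : Fin k → Fin n) : Monotone (gkBeta f) := by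
  intro l m h
  refine Finset.card_le_card fun b => ?_
  simp only [Finset.mem_filter, Finset.mem_univ, true_and]
  exact fun hb => lt_of_lt_of_le hb h

theorem gkBeta_lt {n k : ℕ} (f : Fin k → Fin n) (l) : gkBeta f l < k + 1 :=
  Nat.lt_succ_of_le ((Finset.card_filter_le _ _).trans (by simp))

theorem gkBeta_iff {n k : ℕ} (f : Fin k → Fin n) (hf : StrictMono f) (l : Fin (n+1)) (b : Fin k) :
    (b : ℕ) + 1 ≤ gkBeta f l ↔ (f b).castSucc < l := by
  constructor
  · intro h
    by_contra hcon
    have : (Finset.univ.filter fun b => (f b).castSucc < l) ⊆ Finset.Iio b := by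
      intro c hc
      simp only [Finset.mem_filter, Finset.mem_univ, true_and] at hc
      rw [Finset.mem_Iio]
      by_contra hbc
      have : f b ≤ f c := hf.monotone (not_lt.1 hbc)
      exact hcon (lt_of_le_of_lt (Fin.castSucc_le_castSucc_iff.2 this) hc)
    have := Finset.card_le_card this
    rw [Fin.card_Iio] at this
    unfold gkBeta at h
    omega
  · intro h
    have : Finset.Iic b ⊆ (Finset.univ.filter fun b => (f b).castSucc < l) := by
      intro c hc
      rw [Finset.mem_Iic] at hc
      simp only [Finset.mem_filter, Finset.mem_univ, true_and]
      exact lt_of_le_of_lt (Fin.castSucc_le_castSucc_iff.2 (hf.monotone hc)) h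
    have := Finset.card_le_card this
    rw [Fin.card_Iic] at this
    exact this

theorem gkBeta_surj {n k : ℕ} (f : Fin k → Fin n) (hf : StrictMono f) (c : Fin (k+1)) :
    ∃ l, gkBeta f l = c := by
  induction c using Fin.cases with
  | zero => exact ⟨0, by simp [gkBeta]⟩
  | succ c =>
    refine ⟨(f c).succ, le_antisymm ?_ ?_⟩
    · by_contra hcon
      push Not at hcon
      have hk := gkBeta_lt f (f c).succ
      simp only [Fin.val_succ] at hcon
      have h := (gkBeta_iff f hf (f c).succ ⟨c+1, by omega⟩).1 hcon
      have h2 : f c < f ⟨c+1, by omega⟩ := hf (by simp [Fin.lt_def])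
      simp only [Fin.lt_def, Fin.val_castSucc, Fin.val_succ] at h h2
      omega
    · exact (gkBeta_iff f hf _ c).2 (Fin.castSucc_lt_succ)

theorem gkRow_B {n : ℕ} (C : Matrix (Fin (n+1)) (Fin (n+1)) ℝ) (c : ℝ) (hc : 0 < c)
    (hC : ∀ i, ∑ j, C i j = c) (hrow : GKRow C) : GKRow (gkB C) := by
  intro k i r f hr hf
  rcases Nat.eq_zero_or_pos k with rfl | hk
  · simp
  have hle : i + k ≤ n := by
    have h1 := hr ⟨k-1, by omega⟩
    have h2 := (r ⟨k-1, by omega⟩).isLt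
    simp only at h1
    omega
  let r' : Fin (k+1) → Fin (n+1) := fun a => ⟨i + a, by have := a.isLt; omega⟩
  let M : Matrix (Fin (k+1)) (Fin (k+1)) ℝ :=
    (C.submatrix r' id) * (Matrix.of fun (l : Fin (n+1)) (b : Fin (k+1)) =>
      if gkBeta f l = (b : ℕ) then (1 : ℝ) else 0)
  let T : Matrix (Fin (k+1)) (Fin (k+1)) ℝ := Matrix.of fun a b => if b ≤ a then 1 else 0
  have hT : T.det = 1 := by
    rw [Matrix.det_of_isLowerTriangular T]
    · simp [T]
    · intro a b hab
      have : a < b := hab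
      simp [T, not_le.2 this]
  have hMT : ∀ a b, (M * T) a b = ∑ l, if (b : ℕ) ≤ gkBeta f l then C (r' a) l else 0 := by
    intro a b
    simp only [M, T, Matrix.mul_assoc]
    rw [Matrix.mul_apply]
    refine Finset.sum_congr rfl fun l _ => ?_
    rw [Matrix.mul_apply, Finset.sum_eq_single ⟨gkBeta f l, gkBeta_lt f l⟩]
    · change C (r' a) l * ((if gkBeta f l = gkBeta f l then (1 : ℝ) else 0) *
        (if (b : ℕ) ≤ gkBeta f l then 1 else 0)) = _
      rw [if_pos rfl, one_mul, mul_ite, mul_one, mul_zero]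
    · intro d _ hd
      have : gkBeta f l ≠ d := fun h => hd (Fin.ext h.symm)
      simp [this]
    · simp
  have hM : 0 < M.det := by
    simp only [M]
    rw [gk_det_mul_expand]
    have hnn : ∀ p : Fin (k+1) → Fin (n+1), (∀ b, gkBeta f (p b) = (b : ℕ)) →
        0 < ((C.submatrix r' id).submatrix id p).det := by
      intro p hp
      refine hrow (k+1) i r' p (fun a => rfl) fun a b hab => ?_
      by_contra hcon
      have := gkBeta_mono f (not_lt.1 hcon)
      rw [hp, hp] at this
      exact absurd hab (not_lt.2 this)
    choose p hp using gkBeta_surj f hf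
    refine Finset.sum_pos' (fun q _ => ?_) ⟨p, Finset.mem_univ _, ?_⟩
    · by_cases hq : ∀ b, gkBeta f (q b) = (b : ℕ)
      · exact mul_nonneg (Finset.prod_nonneg fun b _ => by simp [hq b]) (hnn q hq).le
      · push Not at hq
        obtain ⟨b, hb⟩ := hq
        rw [Finset.prod_eq_zero (Finset.mem_univ b) (by simp [hb]), zero_mul]
    · exact mul_pos (Finset.prod_pos fun b _ => by simp [hp b]) (hnn p hp)
  have hdet := gk_det_diff (M * T) c (by intro a; rw [hMT]; simp [hC])
  rw [Matrix.det_mul, hT, mul_one] at hdet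
  have e : (Matrix.of fun a b : Fin k => (M * T) a.succ b.succ - (M * T) a.castSucc b.succ)
      = (gkB C).submatrix r f := by
    ext a b
    simp only [Matrix.of_apply, hMT, Fin.val_succ, gkBeta_iff f hf, Matrix.submatrix_apply, gkB]
    rw [← Finset.sum_sub_distrib]
    refine Finset.sum_congr rfl fun l _ => ?_
    have e1 : r' a.succ = (r a).succ := by ext; simp [r', hr]; omega
    have e2 : r' a.castSucc = (r a).castSucc := by ext; simp [r', hr]
    rw [e1, e2]
    split_ifs <;> simp
  rw [e] at hdet
  rw [hdet] at hM
  exact pos_of_mul_pos_right hM hc.le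

/-- Positivity of left-justified minors. -/
def GKLeft {n : ℕ} (h : Matrix (Fin n) (Fin n) ℝ) : Prop :=
  ∀ (k : ℕ) (hk : k ≤ n) (f : Fin k → Fin n), StrictMono f →
    0 < (h.submatrix f (Fin.castLE hk)).det

theorem gkLeft_lift {n : ℕ} (h : Matrix (Fin (n+1)) (Fin (n+1)) ℝ) (h' : Matrix (Fin n) (Fin n) ℝ)
    (h0 : ∀ i, h i 0 = 1) (hd : ∀ i j : Fin n, h i.succ j.succ - h i.castSucc j.succ = h' i j)
    (hl : GKLeft h') : GKLeft h := by
  intro k hk f hf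
  rcases k with _ | k
  · simp
  have hk' : k ≤ n := by omega
  rw [gk_det_diff _ 1 (by intro a; simpa using h0 _), one_mul]
  let W : Matrix (Fin k) (Fin n) ℝ := Matrix.of fun a j =>
    if f a.castSucc ≤ j.castSucc ∧ j.castSucc < f a.succ then 1 else 0
  have e : (Matrix.of fun a b : Fin k => (h.submatrix f (Fin.castLE hk)) a.succ b.succ
      - (h.submatrix f (Fin.castLE hk)) a.castSucc b.succ)
      = W * (h'.submatrix id (Fin.castLE hk')) := by
    ext a b
    have hb : Fin.castLE hk b.succ = (Fin.castLE hk' b).succ := by ext; simp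
    simp only [Matrix.of_apply, Matrix.submatrix_apply, hb, Matrix.mul_apply, W]
    rw [gk_telescope (fun i => h i (Fin.castLE hk' b).succ) _ _
      (hf.monotone (Fin.castSucc_lt_succ (i := a)).le)]
    refine Finset.sum_congr rfl fun j _ => ?_
    rw [hd]
    split_ifs <;> simp
  rw [e, gk_det_mul_expand']
  have hnn : ∀ q : Fin k → Fin n,
      (∀ a, f a.castSucc ≤ (q a).castSucc ∧ (q a).castSucc < f a.succ) →
      0 < ((h'.submatrix id (Fin.castLE hk')).submatrix q id).det := by
    intro q hq
    refine hl k hk' q fun a b hab => ?_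
    have h1 : f a.succ ≤ f b.castSucc := hf.monotone (by
      simp only [Fin.le_def, Fin.lt_def, Fin.val_succ, Fin.val_castSucc] at *; omega)
    exact Fin.castSucc_lt_castSucc_iff.1 ((hq a).2.trans_le (h1.trans (hq b).1))
  have hex : ∀ a : Fin k, ∃ j : Fin n, f a.castSucc ≤ j.castSucc ∧ j.castSucc < f a.succ := by
    intro a
    have h1 : f a.castSucc < f a.succ := hf (Fin.castSucc_lt_succ)
    have h2 : f a.castSucc ≠ Fin.last n := (h1.trans_le (Fin.le_last _)).ne
    refine ⟨(f a.castSucc).castPred h2, ?_⟩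
    simpa using h1
  choose p hp using hex
  refine Finset.sum_pos' (fun q _ => ?_) ⟨p, Finset.mem_univ _, ?_⟩
  · by_cases hq : ∀ a, f a.castSucc ≤ (q a).castSucc ∧ (q a).castSucc < f a.succ
    · exact mul_nonneg (Finset.prod_nonneg fun b _ => by simp [W, hq b]) (hnn q hq).le
    · push Not at hq
      obtain ⟨b, hb⟩ := hq
      rw [Finset.prod_eq_zero (Finset.mem_univ b), zero_mul]
      simp only [W, Matrix.of_apply]
      rw [if_neg]
      rintro ⟨x, y⟩
      exact absurd y (not_lt.2 (hb x))
  · exact mul_pos (Finset.prod_pos fun b _ => by simp [W, hp b]) (hnn p hp)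

theorem gk_lt {n : ℕ} (C : Matrix (Fin (n+1)) (Fin (n+1)) ℝ) (c : ℝ)
    (hC : ∀ i, ∑ j, C i j = c) (hpos : ∀ i j, 0 < C i j) (y : Fin (n+1) → ℝ) (m t : ℝ)
    (hy : ∀ i, ∑ l, C i l * y l = m * y i + t) (hne : ∃ i j, y i ≠ y j) : m < c := by
  obtain ⟨a, -, ha⟩ := Finset.exists_max_image Finset.univ y Finset.univ_nonempty
  obtain ⟨b, -, hb⟩ := Finset.exists_min_image Finset.univ y Finset.univ_nonempty
  have hba : y b < y a := by
    by_contra hcon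
    obtain ⟨i, j, hij⟩ := hne
    have h1 := ha i (Finset.mem_univ _)
    have h2 := hb i (Finset.mem_univ _)
    have h3 := ha j (Finset.mem_univ _)
    have h4 := hb j (Finset.mem_univ _)
    apply hij
    linarith
  have h1 : ∑ l, C a l * y l < ∑ l, C a l * y a :=
    Finset.sum_lt_sum (fun l _ => mul_le_mul_of_nonneg_left (ha l (Finset.mem_univ _)) (hpos _ _).le)
      ⟨b, Finset.mem_univ _, mul_lt_mul_of_pos_left hba (hpos _ _)⟩
  have h2 : ∑ l, C b l * y b < ∑ l, C b l * y l :=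
    Finset.sum_lt_sum (fun l _ => mul_le_mul_of_nonneg_left (hb l (Finset.mem_univ _)) (hpos _ _).le)
      ⟨a, Finset.mem_univ _, mul_lt_mul_of_pos_left hba (hpos _ _)⟩
  rw [hy, ← Finset.sum_mul, hC] at h1 h2
  nlinarith

theorem gk_main (n : ℕ) (A : Matrix (Fin n) (Fin n) ℝ) (hA : GKRow A) :
    ∃ lam : Fin n → ℝ, StrictAnti lam ∧ (∀ i, 0 < lam i) ∧
      ∃ h : Matrix (Fin n) (Fin n) ℝ, A * h = h * Matrix.diagonal lam ∧ GKLeft h := by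
  induction n with
  | zero =>
    refine ⟨fun _ => 1, fun a => a.elim0, fun a => a.elim0, 1, by ext a; exact a.elim0, ?_⟩
    intro k hk f _
    obtain rfl : k = 0 := by omega
    simp
  | succ n ih =>
    have hApos : ∀ i j, 0 < A i j := by
      intro i j
      have := hA 1 i (fun _ => i) (fun _ => j) (by intro a; simp) (Subsingleton.strictMono _)
      simpa using this
    obtain ⟨c, u, hc, hu, hAu⟩ := gk_perron A hApos
    let C : Matrix (Fin (n+1)) (Fin (n+1)) ℝ := Matrix.of fun i j => (u i)⁻¹ * (A i j * u j)
    have hC : ∀ i, ∑ j, C i j = c := by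
      intro i
      simp only [C, Matrix.of_apply]
      rw [← Finset.mul_sum, hAu]
      field_simp [(hu i).ne']
    have hCpos : ∀ i j, 0 < C i j := fun i j =>
      mul_pos (inv_pos.2 (hu i)) (mul_pos (hApos i j) (hu j))
    have hCrow : GKRow C := by
      intro k i r f hr hf
      have e : C.submatrix r f = Matrix.of fun a b => (u (r a))⁻¹ *
          (Matrix.of fun a b => u (f b) * A.submatrix r f a b) a b := by
        ext a b; simp [C, mul_comm]
      rw [e, Matrix.det_mul_column, Matrix.det_mul_row]
      exact mul_pos (Finset.prod_pos fun a _ => inv_pos.2 (hu _))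
        (mul_pos (Finset.prod_pos fun a _ => hu _) (hA k i r f hr hf))
    obtain ⟨mu, hmu, hmupos, h', hBh, hleft⟩ := ih (gkB C) (gkRow_B C c hc hC hCrow)
    have hdet' : h'.det ≠ 0 := by
      have := hleft n le_rfl id strictMono_id
      simpa using this.ne'
    have hlift : ∀ j : Fin n, mu j < c ∧ ∃ y : Fin (n+1) → ℝ,
        (∀ i, ∑ l, C i l * y l = mu j * y i) ∧ ∀ i : Fin n, y i.succ - y i.castSucc = h' i j := by
      intro j
      let y0 : Fin (n+1) → ℝ := fun l => ∑ i : Fin n, if i.castSucc < l then h' i j else 0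
      have hy0 : ∀ i : Fin n, y0 i.succ - y0 i.castSucc = h' i j := by
        intro i
        simp only [y0]
        rw [← Finset.sum_sub_distrib, Finset.sum_eq_single i]
        · simp
        · intro l _ hl
          have h2 : (l : ℕ) ≠ i := fun h => hl (Fin.ext h)
          have : (l.castSucc < i.succ) ↔ (l.castSucc < i.castSucc) := by
            simp only [Fin.lt_def, Fin.val_castSucc, Fin.val_succ]; omega
          simp [this]
        · simp
      have hB : ∀ i, ∑ l, gkB C i l * h' l j = mu j * h' i j := by
        intro i
        have := congrFun (congrFun hBh i) j
        rw [Matrix.mul_apply, Matrix.mul_diagonal] at this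
        rw [this, mul_comm]
      let z : Fin (n+1) → ℝ := fun i => ∑ l, C i l * y0 l - mu j * y0 i
      have hz : ∀ i, z i = z 0 := by
        intro i
        induction i using Fin.induction with
        | zero => rfl
        | succ i hi =>
          rw [← hi]
          have h1 := gk_intertwine C c hC y0 i
          simp only [hy0, hB] at h1
          rw [← hy0 i] at h1
          simp only [z]
          linarith
      have hy1 : ∀ i, ∑ l, C i l * y0 l = mu j * y0 i + z 0 := by
        intro i
        rw [← hz i]; simp only [z]; ring
      have hlt : mu j < c := by
        refine gk_lt C c hC hCpos y0 (mu j) (z 0) hy1 ?_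
        by_contra hcon
        push Not at hcon
        apply hdet'
        refine Matrix.det_eq_zero_of_column_eq_zero j fun i => ?_
        rw [← hy0 i, hcon i.succ i.castSucc, sub_self]
      refine ⟨hlt, fun l => y0 l - z 0 / (c - mu j), fun i => ?_, fun i => ?_⟩
      · simp only [mul_sub, Finset.sum_sub_distrib]
        rw [hy1, ← Finset.sum_mul, hC]
        have : c - mu j ≠ 0 := (sub_pos.2 hlt).ne'
        field_simp
        ring
      · rw [← hy0 i]; ring
    choose hlt Y hY hYd using hlift
    let hC' : Matrix (Fin (n+1)) (Fin (n+1)) ℝ :=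
      Matrix.of fun i j => (Fin.cons (fun _ => 1) Y : Fin (n+1) → Fin (n+1) → ℝ) j i
    have hCleft : GKLeft hC' := by
      refine gkLeft_lift hC' h' (fun i => by simp [hC']) (fun i j => ?_) hleft
      simp [hC', hYd]
    have hCeig : ∀ i j, ∑ l, C i l * hC' l j = (Fin.cons c mu : Fin (n+1) → ℝ) j * hC' i j := by
      intro i j
      induction j using Fin.cases with
      | zero => simp [hC', hC]
      | succ j => simp [hC', hY]
    refine ⟨Fin.cons c mu, ?_, ?_, Matrix.of fun i j => u i * hC' i j, ?_, ?_⟩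
    · intro a b hab
      induction b using Fin.cases with
      | zero => exact absurd hab (by simp)
      | succ b =>
        induction a using Fin.cases with
        | zero => simpa using hlt b
        | succ a => simpa using hmu (by simpa using hab)
    · intro i
      induction i using Fin.cases with
      | zero => simpa using hc
      | succ i => simpa using hmupos i
    · ext i j
      rw [Matrix.mul_apply, Matrix.mul_diagonal]
      have := hCeig i j
      simp only [C, Matrix.of_apply] at this ⊢
      have h2 : ∑ l, (u i)⁻¹ * (A i l * u l) * hC' l j = (u i)⁻¹ * ∑ l, A i l * (u l * hC' l j) := by
        rw [Finset.mul_sum]; exact Finset.sum_congr rfl fun l _ => by ring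
      rw [h2, inv_mul_eq_iff_eq_mul₀ (hu i).ne'] at this
      rw [this]; ring
    · intro k hk f hf
      have e : (Matrix.of fun i j => u i * hC' i j).submatrix f (Fin.castLE hk)
          = Matrix.of fun a b => u (f a) * (hC'.submatrix f (Fin.castLE hk)) a b := by
        ext a b; simp
      rw [e, Matrix.det_mul_column]
      exact mul_pos (Finset.prod_pos fun a _ => hu _) (hCleft k hk f hf)

theorem gk_minorOn {n k : ℕ} (g : Matrix (Fin n) (Fin n) ℝ) (r f : Fin k → Fin n)
    (hr : StrictMono r) (hf : StrictMono f) :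
    minorOn g (Finset.univ.image r) (Finset.univ.image f) = (g.submatrix r f).det := by
  have hI : (Finset.univ.image r).card = k := by
    rw [Finset.card_image_of_injective _ hr.injective]; simp
  have hJ : (Finset.univ.image f).card = k := by
    rw [Finset.card_image_of_injective _ hf.injective]; simp
  unfold minorOn
  rw [dif_pos (hJ.trans hI.symm)]
  have er : ∀ a, ((Finset.univ.image r).orderIsoOfFin rfl a : Fin n) = r (Fin.cast hI a) := by
    intro a
    have h := Finset.orderEmbOfFin_unique (s := Finset.univ.image r) rfl
      (f := fun a => r (Fin.cast hI a)) (by intro x; simp) (by intro x y h; exact hr h)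
    rw [Finset.coe_orderIsoOfFin_apply, ← h]
  have ef : ∀ a, ((Finset.univ.image f).orderIsoOfFin (hJ.trans hI.symm) a : Fin n)
      = f (Fin.cast hI a) := by
    intro a
    have h := Finset.orderEmbOfFin_unique (s := Finset.univ.image f) (hJ.trans hI.symm)
      (f := fun a => f (Fin.cast hI a)) (by intro x; simp) (by intro x y h; exact hf h)
    rw [Finset.coe_orderIsoOfFin_apply, ← h]
  simp only [er, ef]
  exact Matrix.det_submatrix_equiv_self (finCongr hI) (g.submatrix r f)

theorem gk_leftMinor {n : ℕ} (h : Matrix (Fin n) (Fin n) ℝ) (hl : GKLeft h) (I : Finset (Fin n)) :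
    0 < leftMinor h I := by
  have hk : I.card ≤ n := by simpa using Finset.card_le_univ I
  have h1 : Finset.univ.image (I.orderEmbOfFin rfl) = I := by simp
  have h2 : (Finset.univ.filter fun j : Fin n => (j : ℕ) < I.card)
      = Finset.univ.image (Fin.castLE hk) := by
    ext j
    simp only [Finset.mem_filter, Finset.mem_univ, true_and, Finset.mem_image]
    constructor
    · intro hj; exact ⟨⟨j, hj⟩, by ext; simp⟩
    · rintro ⟨a, rfl⟩; simp
  have h3 := gk_minorOn h (I.orderEmbOfFin rfl) (Fin.castLE hk) (I.orderEmbOfFin rfl).strictMono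
    (Fin.strictMono_castLE hk)
  rw [h1] at h3
  unfold leftMinor
  rw [h2, h3]
  exact hl _ hk _ (I.orderEmbOfFin rfl).strictMono

/-- (Gantmakher–Krein.) A real `n×n` matrix all of whose minors (of
every order `1,…,n`) are positive has `n` distinct positive real eigenvalues
`λ₁ > ⋯ > λₙ > 0`, i.e. its characteristic polynomial is `∏ᵢ (X − λᵢ)` with `λ`
strictly decreasing and positive; moreover there is an invertible real matrix `h` with
`h⁻¹ g h = diag(λ₁,…,λₙ)` and all left-justified minors of `h` positive. -/
theorem gantmakher_krein_eigenvalues {n : ℕ} (g : Matrix (Fin n) (Fin n) ℝ)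
    (hg : ∀ I J : Finset (Fin n), I.Nonempty → I.card = J.card → 0 < minorOn g I J) :
    ∃ lam : Fin n → ℝ,
      StrictAnti lam ∧ (∀ i, 0 < lam i) ∧
      g.charpoly = ∏ i : Fin n, (Polynomial.X - Polynomial.C (lam i)) ∧
      ∃ h : Matrix (Fin n) (Fin n) ℝ,
        IsUnit h ∧ h⁻¹ * g * h = Matrix.diagonal lam ∧
        ∀ I : Finset (Fin n), 0 < leftMinor h I := by
  have hrow : GKRow g := by
    intro k i r f hr hf
    rcases Nat.eq_zero_or_pos k with rfl | hk
    · simp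
    have hr' : StrictMono r := by
      intro a b hab
      rw [Fin.lt_def] at hab ⊢
      rw [hr, hr]; omega
    rw [← gk_minorOn g r f hr' hf]
    refine hg _ _ ⟨r ⟨0, hk⟩, by simp⟩ ?_
    rw [Finset.card_image_of_injective _ hr'.injective,
      Finset.card_image_of_injective _ hf.injective]
  obtain ⟨lam, h1, h2, h, h3, h4⟩ := gk_main n g hrow
  have hdet : IsUnit h.det := by
    have := h4 n le_rfl id strictMono_id
    simpa using this.ne'
  have hdiag : h⁻¹ * g * h = Matrix.diagonal lam := by
    rw [Matrix.mul_assoc, h3, ← Matrix.mul_assoc, Matrix.nonsing_inv_mul _ hdet, Matrix.one_mul]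
  have hu : IsUnit h := (Matrix.isUnit_iff_isUnit_det h).2 hdet
  refine ⟨lam, h1, h2, ?_, h, hu, hdiag, gk_leftMinor h h4⟩
  obtain ⟨U, rfl⟩ := hu
  rw [← Matrix.charpoly_diagonal, ← hdiag, Matrix.charpoly_units_conj']
end

section
/- Let V be a complex n×k matrix of rank k, so that the Gram matrix V*V is invertible, and let P := V(V*V)⁻¹V* be the orthogonal projection onto the column span of V. For a subset S of {1,…,n} with |S| = k write Δ_S(V) := det(V_{S,{1,…,k}}), and for finite sets A, B of integers write inv(A,B) := #{(a,b) ∈ A×B : a > b}. Then for every 1 ≤ l ≤ n and all subsets I, J of {1,…,n} with |I| = |J| = l: Δ_{I,J}(P) = ( Σ_K (−1)^{inv(I,K)+inv(J,K)} Δ_{I∪K}(V)·conj(Δ_{J∪K}(V)) ) / ( Σ_{K'} |Δ_{K'}(V)|² ), where K ranges over all subsets of {1,…,n}∖(I∪J) of cardinality k−l and K' ranges over all subsets of {1,…,n} of cardinality k. In particular, for |I| = |J| = k, Δ_{I,J}(P) = Δ_I(V)·conj(Δ_J(V)) / Σ_{K'} |Δ_{K'}(V)|². -/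
open Matrix Finset

/-- The minor of an `n×k` matrix on a set `S` of `k` rows (all `k` columns);
`0` if `|S| ≠ k`. -/
noncomputable def rowMinor {n k : ℕ} (B : Matrix (Fin n) (Fin k) ℂ) (S : Finset (Fin n)) : ℂ :=
  if h : S.card = k then
    Matrix.det (Matrix.of fun a b : Fin k => B ((S.orderIsoOfFin h a : Fin n)) b)
  else 0

/-- `inv(A,B) = #{(a,b) ∈ A×B : a > b}`. -/
def pairInv {n : ℕ} (A B : Finset (Fin n)) : ℕ :=
  ((A ×ˢ B).filter fun p => p.2 < p.1).card

theorem bordered_det {α : Type} [Fintype α] [DecidableEq α] (A : Matrix α α ℂ)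
    (b : α → ℂ) (c : α → ℂ) (d : ℂ) :
    det (fromBlocks A (of fun x (_ : Unit) => b x) (of fun (_ : Unit) y => c y)
      (of fun (_ : Unit) (_ : Unit) => d)) = d * det A - ∑ a, c a * A.cramer b a := by
  rw [det_eq_sum_mul_adjugate_row _ (Sum.inr ())]
  rw [Fintype.sum_sum_type]
  simp only [adjugate_apply, fromBlocks_apply₂₁, fromBlocks_apply₂₂, of_apply,
    Finset.univ_unique, Finset.sum_singleton, PUnit.default_eq_unit]
  have h1 : ∀ M : Matrix (α ⊕ Unit) (α ⊕ Unit) ℂ, M = fromBlocks A (of fun x (_ : Unit) => b x) 0 1 →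
      det M = det A := by
    rintro _ rfl
    rw [det_fromBlocks_zero₂₁]; simp
  rw [h1 (updateRow _ _ (Pi.single (Sum.inr ()) 1))]
  · rw [add_comm, sub_eq_add_neg, ← Finset.sum_neg_distrib]
    congr 1
    refine Finset.sum_congr rfl fun a _ => ?_
    rw [cramer_apply, ← mul_neg]
    congr 1
    have h := det_permute' (Equiv.swap (Sum.inl a : α ⊕ Unit) (Sum.inr ()))
      (updateRow (fromBlocks A (of fun x (_ : Unit) => b x) (of fun (_ : Unit) y => c y)
      (of fun (_ : Unit) (_ : Unit) => d)) (Sum.inr ()) (Pi.single (Sum.inl a) 1))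
    rw [Equiv.Perm.sign_swap (by simp)] at h
    have h2 : (updateRow (fromBlocks A (of fun x (_ : Unit) => b x) (of fun (_ : Unit) y => c y)
      (of fun (_ : Unit) (_ : Unit) => d)) (Sum.inr ()) (Pi.single (Sum.inl a) 1)).submatrix id
        (Equiv.swap (Sum.inl a : α ⊕ Unit) (Sum.inr ())) =
        fromBlocks (updateCol A a b) (of fun x (_ : Unit) => A x a) 0 1 := by
      ext x y
      rcases x with x | x <;> rcases y with y | y
      · by_cases hy : y = a
        · subst hy; simp [updateRow_apply]
        · rw [submatrix_apply, Equiv.swap_apply_of_ne_of_ne (by simpa using hy) (by simp)]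
          simp [updateRow_apply, hy]
      · simp [updateRow_apply]
      · by_cases hy : y = a
        · subst hy; simp [updateRow_apply]
        · rw [submatrix_apply, Equiv.swap_apply_of_ne_of_ne (by simpa using hy) (by simp)]
          simp [updateRow_apply, hy]
      · simp [updateRow_apply]
    rw [h2, det_fromBlocks_zero₂₁] at h
    simp only [det_one, mul_one] at h
    rw [h]; simp
  · ext x y
    rcases x with x | x <;> rcases y with y | y <;> simp [updateRow_apply]

theorem proj_step {ι α : Type} [Fintype ι] [DecidableEq ι] [Fintype α] [DecidableEq α]
    (P : Matrix ι ι ℂ) (hP : P * P = P) (i j : α → ι) :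
    ∑ r, det (P.submatrix (Sum.elim i (fun _ : Unit => r)) (Sum.elim j (fun _ : Unit => r))) =
      (P.trace - Fintype.card α) * det (P.submatrix i j) := by
  have h : ∀ r, det (P.submatrix (Sum.elim i (fun _ : Unit => r)) (Sum.elim j (fun _ : Unit => r)))
      = P r r * det (P.submatrix i j)
        - ∑ a, P r (j a) * (P.submatrix i j).cramer (fun x => P (i x) r) a := by
    intro r
    rw [← bordered_det]
    congr 1
    ext x y
    rcases x with x | x <;> rcases y with y | y <;> simp
  simp only [h, Finset.sum_sub_distrib]
  rw [← Finset.sum_mul, Finset.sum_comm, sub_mul]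
  congr 1
  have h2 : ∀ a, ∑ r, P r (j a) * (P.submatrix i j).cramer (fun x => P (i x) r) a =
      det (P.submatrix i j) := by
    intro a
    have : ∑ r, P r (j a) • (fun x => P (i x) r) = fun x => (P.submatrix i j) x a := by
      ext x
      have := congrFun (congrFun hP (i x)) (j a)
      rw [mul_apply] at this
      simp only [Finset.sum_apply, Pi.smul_apply, smul_eq_mul, submatrix_apply]
      rw [← this]
      exact Finset.sum_congr rfl fun r _ => mul_comm _ _
    have h3 := congrArg (fun v => (P.submatrix i j).cramer v a) this
    simp only [map_sum, map_smul, Finset.sum_apply, Pi.smul_apply, smul_eq_mul] at h3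
    rw [h3, cramer_apply]
    congr 1
    ext x y
    by_cases hy : y = a
    · subst hy; simp
    · simp [hy]
  simp [h2]

def stepEquiv (α : Type) (q : ℕ) : (α ⊕ Unit) ⊕ Fin q ≃ α ⊕ Fin (q + 1) where
  toFun := Sum.elim (Sum.elim Sum.inl (fun _ => Sum.inr 0)) (fun x => Sum.inr x.succ)
  invFun := Sum.elim (fun a => Sum.inl (Sum.inl a))
    (Fin.cases (Sum.inl (Sum.inr ())) (fun x => Sum.inr x))
  left_inv := by rintro ((a | a) | a) <;> simp
  right_inv := by
    rintro (a | a)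
    · simp
    · induction a using Fin.cases <;> simp

theorem proj_iter {ι : Type} [Fintype ι] [DecidableEq ι] (P : Matrix ι ι ℂ) (hP : P * P = P)
    (k : ℕ) (hk : P.trace = k) (q : ℕ) :
    ∀ (α : Type) [Fintype α] [DecidableEq α] (i j : α → ι), Fintype.card α + q = k →
      ∑ g : Fin q → ι, det (P.submatrix (Sum.elim i g) (Sum.elim j g)) =
        (q.factorial : ℂ) * det (P.submatrix i j) := by
  induction q with
  | zero =>
    intro α _ _ i j h
    simp only [Finset.univ_unique, Finset.sum_singleton, Nat.factorial_zero, Nat.cast_one, one_mul]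
    rw [← det_submatrix_equiv_self (Equiv.sumEmpty α (Fin 0)).symm]
    rfl
  | succ q ih =>
    intro α _ _ i j h
    rw [← (Fin.consEquiv (fun _ : Fin (q+1) => ι)).sum_comp, Fintype.sum_prod_type]
    have h1 : ∀ r, ∑ g : Fin q → ι, det (P.submatrix
        (Sum.elim i (Fin.consEquiv (fun _ : Fin (q+1) => ι) (r, g)))
        (Sum.elim j (Fin.consEquiv (fun _ : Fin (q+1) => ι) (r, g)))) =
        (q.factorial : ℂ) * det (P.submatrix (Sum.elim i (fun _ : Unit => r))
          (Sum.elim j (fun _ : Unit => r))) := by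
      intro r
      rw [← ih (α ⊕ Unit) _ _ (by simp; omega)]
      refine Finset.sum_congr rfl fun g _ => ?_
      rw [← det_submatrix_equiv_self (stepEquiv α q), submatrix_submatrix]
      congr 2
      · ext ((a | a) | a) <;> simp [stepEquiv, Fin.consEquiv]
      · ext ((a | a) | a) <;> simp [stepEquiv, Fin.consEquiv]
    simp only [h1]
    rw [← Finset.mul_sum, proj_step P hP, hk, ← h, Nat.factorial_succ]
    push_cast
    ring

theorem sign_sort {n l q : ℕ} (I K : Finset (Fin n)) (hI : I.card = l) (hK : K.card = q)
    (σ : Equiv.Perm (Fin (l + q))) (u : Fin (l + q) → Fin n) (hu : StrictMono u)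
    (h : ∀ x, u (σ x) = Fin.append (I.orderEmbOfFin hI) (K.orderEmbOfFin hK) x)
    (hd : Disjoint I K) :
    ((Equiv.Perm.sign σ : ℤ) : ℂ) = (-1) ^ pairInv I K := by
  have h0 : (Equiv.Perm.sign σ) = (-1) ^ pairInv I K := by
    rw [Equiv.Perm.sign_eq_prod_prod_Iio]
    simp only [← hu.lt_iff_lt, h]
    have e : ∀ j : Fin (l + q), Finset.Iio j = Finset.univ.filter (fun i => i < j) := by
      intro j; ext; simp
    simp only [e, Finset.prod_filter]
    rw [Fin.prod_univ_add]
    simp only [Fin.prod_univ_add, Fin.append_left, Fin.append_right]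
    have a1 : ∀ (x : Fin l) (y : Fin q), ¬ (Fin.natAdd l y < Fin.castAdd q x) := by
      intro x y; rw [Fin.lt_def, Fin.val_natAdd, Fin.val_castAdd]; omega
    have a2 : ∀ (x : Fin l) (y : Fin q), (Fin.castAdd q x < Fin.natAdd l y) := by
      intro x y; rw [Fin.lt_def, Fin.val_natAdd, Fin.val_castAdd]; omega
    have a3 : ∀ x y : Fin l, (Fin.castAdd q x < Fin.castAdd q y) ↔ x < y := by
      intro x y; simp only [Fin.lt_def, Fin.val_natAdd, Fin.val_castAdd, Nat.add_lt_add_iff_left]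
    have a4 : ∀ x y : Fin q, (Fin.natAdd l x < Fin.natAdd l y) ↔ x < y := by
      intro x y; simp only [Fin.lt_def, Fin.val_natAdd, Fin.val_castAdd, Nat.add_lt_add_iff_left]
    simp only [a1, a2, a3, a4, if_true, if_false, OrderEmbedding.lt_iff_lt]
    have a5 : ∀ x y : Fin l, (if x < y then (if x < y then (1 : ℤˣ) else -1) else 1) = 1 := by
      intro x y; split_ifs <;> rfl
    have a6 : ∀ x y : Fin q, (if x < y then (if x < y then (1 : ℤˣ) else -1) else 1) = 1 := by
      intro x y; split_ifs <;> rfl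
    simp only [a5, a6, Finset.prod_const_one, one_mul, mul_one]
    have b1 : ∀ f : Fin n → ℤˣ, ∏ x : Fin l, f (I.orderEmbOfFin hI x) = ∏ x ∈ I, f x := by
      intro f
      rw [← Finset.prod_coe_sort I f, ← (I.orderIsoOfFin hI).toEquiv.prod_comp]
      rfl
    have b2 : ∀ f : Fin n → ℤˣ, ∏ x : Fin q, f (K.orderEmbOfFin hK x) = ∏ x ∈ K, f x := by
      intro f
      rw [← Finset.prod_coe_sort K f, ← (K.orderIsoOfFin hK).toEquiv.prod_comp]
      rfl
    rw [b2 (fun y => ∏ x : Fin l, if I.orderEmbOfFin hI x < y then (1 : ℤˣ) else -1)]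
    simp only [fun y => b1 (fun x => if x < y then (1 : ℤˣ) else -1)]
    rw [Finset.prod_comm, ← Finset.prod_product', pairInv, ← Finset.prod_const,
      Finset.prod_filter]
    refine Finset.prod_congr rfl fun p hp => ?_
    rw [Finset.mem_product] at hp
    have : p.1 ≠ p.2 := fun e => Finset.disjoint_left.1 hd hp.1 (e ▸ hp.2)
    rcases lt_or_gt_of_ne this with h | h
    · simp [h, h.not_gt]
    · simp [h, h.not_gt]
  rw [h0]
  push_cast
  simp

theorem exists_sort_perm {m n : ℕ} (f : Fin m → Fin n) (hf : Function.Injective f)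
    (S : Finset (Fin n)) (h : S.card = m) (hS : ∀ x, f x ∈ S) :
    ∃ σ : Equiv.Perm (Fin m), ∀ x, S.orderEmbOfFin h (σ x) = f x := by
  let s : Fin m → Fin m := fun x => (S.orderIsoOfFin h).symm ⟨f x, hS x⟩
  have hs : ∀ x, S.orderEmbOfFin h (s x) = f x := by
    intro x
    simp [s, ← Finset.coe_orderIsoOfFin_apply]
  have hinj : Function.Injective s := by
    intro x y hxy
    apply hf
    rw [← hs x, ← hs y, hxy]
  exact ⟨Equiv.ofBijective s (Finite.injective_iff_bijective.1 hinj), hs⟩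

theorem rowMinor_append {n l q : ℕ} (V : Matrix (Fin n) (Fin (l + q)) ℂ) (I K : Finset (Fin n))
    (hI : I.card = l) (hK : K.card = q) (hd : Disjoint I K) :
    det (V.submatrix (Fin.append (I.orderEmbOfFin hI) (K.orderEmbOfFin hK)) id) =
      (-1) ^ pairInv I K * rowMinor V (I ∪ K) := by
  have hc : (I ∪ K).card = l + q := by rw [Finset.card_union_of_disjoint hd, hI, hK]
  have hinj : Function.Injective (Fin.append (I.orderEmbOfFin hI) (K.orderEmbOfFin hK)) := by
    rw [Fin.append_injective_iff]
    refine ⟨(I.orderEmbOfFin hI).injective, (K.orderEmbOfFin hK).injective, ?_⟩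
    intro x y e
    exact Finset.disjoint_left.1 hd (Finset.orderEmbOfFin_mem I hI x)
      (e ▸ Finset.orderEmbOfFin_mem K hK y)
  obtain ⟨σ, hσ⟩ := exists_sort_perm _ hinj (I ∪ K) hc (by
    intro x
    induction x using Fin.addCases with
    | left x =>
      rw [Fin.append_left]
      exact Finset.mem_union_left _ (Finset.orderEmbOfFin_mem I hI x)
    | right x =>
      rw [Fin.append_right]
      exact Finset.mem_union_right _ (Finset.orderEmbOfFin_mem K hK x))
  rw [← sign_sort I K hI hK σ _ ((I ∪ K).orderEmbOfFin hc).strictMono hσ hd]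
  have h1 : rowMinor V (I ∪ K) = det (V.submatrix ((I ∪ K).orderEmbOfFin hc) id) := by
    rw [rowMinor, dif_pos hc]; rfl
  rw [h1, ← det_permute, submatrix_submatrix]
  congr 2
  ext x
  exact congrArg Fin.val (hσ x).symm

theorem sum_fun_to_sets {n q : ℕ} (S : Finset (Fin n)) (F : (Fin q → Fin n) → ℂ)
    (T : Finset (Fin n) → ℂ)
    (h0 : ∀ g, ¬ Function.Injective g → F g = 0)
    (h1 : ∀ g x, g x ∈ S → F g = 0)
    (h2 : ∀ g (σ : Equiv.Perm (Fin q)), F (g ∘ σ) = F g)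
    (hT : ∀ K (h : K.card = q), Disjoint S K → F (K.orderEmbOfFin h) = T K) :
    ∑ g, F g = (q.factorial : ℂ) * ∑ K ∈ Finset.powersetCard q (Finset.univ \ S), T K := by
  classical
  have e1 : ∑ g, F g = ∑ g ∈ Finset.univ.filter (fun g : Fin q → Fin n =>
      Finset.univ.image g ∈ Finset.powersetCard q (Finset.univ \ S)), F g := by
    symm
    apply Finset.sum_filter_of_ne
    intro g _ hg
    have a : Function.Injective g := by
      by_contra h; exact hg (h0 g h)
    have b : ∀ x, g x ∉ S := fun x h => hg (h1 g x h)
    rw [Finset.mem_powersetCard]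
    refine ⟨?_, by rw [Finset.card_image_of_injective _ a]; simp⟩
    intro y hy
    obtain ⟨x, _, rfl⟩ := Finset.mem_image.1 hy
    simp [b x]
  rw [e1, ← Finset.sum_fiberwise_of_maps_to (t := Finset.powersetCard q (Finset.univ \ S))
    (g := fun g => Finset.univ.image g) (fun g hg => (Finset.mem_filter.1 hg).2), Finset.mul_sum]
  refine Finset.sum_congr rfl fun K hK => ?_
  have hK' := Finset.mem_powersetCard.1 hK
  have hd : Disjoint S K := by
    rw [Finset.disjoint_left]
    intro x hx hx'
    have := hK'.1 hx'
    simp [hx] at this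
  have e2 : ((Finset.univ.filter (fun g : Fin q → Fin n =>
      Finset.univ.image g ∈ Finset.powersetCard q (Finset.univ \ S))).filter
        (fun g => Finset.univ.image g = K)) =
      Finset.univ.image (fun σ : Equiv.Perm (Fin q) => (K.orderEmbOfFin hK'.2 : Fin q → Fin n) ∘ σ) := by
    ext g
    simp only [Finset.mem_filter, Finset.mem_univ, true_and, Finset.mem_image]
    constructor
    · rintro ⟨-, hg⟩
      have a : Function.Injective g := by
        have : Set.InjOn g (Finset.univ : Finset (Fin q)) := by
          rw [← Finset.card_image_iff, hg, hK'.2]; simp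
        simpa using this
      obtain ⟨σ, hσ⟩ := exists_sort_perm g a K hK'.2 (by intro x; rw [← hg]; simp)
      exact ⟨σ, funext hσ⟩
    · rintro ⟨σ, rfl⟩
      have : Finset.univ.image ((K.orderEmbOfFin hK'.2 : Fin q → Fin n) ∘ σ) = K := by
        rw [← Finset.image_image, Finset.image_univ_equiv]
        ext x
        rw [← Finset.mem_coe, Finset.coe_image, Finset.coe_univ, Set.image_univ,
          Finset.range_orderEmbOfFin, Finset.mem_coe]
      exact ⟨this.symm ▸ hK, this⟩
  rw [e2, Finset.sum_image]
  · simp [h2, hT K hK'.2 hd, Fintype.card_perm]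
  · intro σ _ τ _ h
    ext x
    exact congrArg Fin.val ((K.orderEmbOfFin hK'.2).injective (congrFun h x))

open scoped ComplexOrder in
theorem gram_isUnit {n k : ℕ} (V : Matrix (Fin n) (Fin k) ℂ) (hV : V.rank = k) :
    IsUnit (Vᴴ * V).det := by
  have h : LinearIndependent ℂ (Vᴴ * V).row := by
    rw [linearIndependent_iff_card_eq_finrank_span, Set.finrank, ← rank_eq_finrank_span_row,
      rank_conjTranspose_mul_self, hV]
    simp
  rw [← isUnit_iff_isUnit_det]
  exact linearIndependent_rows_iff_isUnit.1 h

theorem main_minor {n k q : ℕ} (V : Matrix (Fin n) (Fin k) ℂ) (hV : V.rank = k)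
    (I J : Finset (Fin n)) (hJ : J.card = I.card) (hk : I.card + q = k) :
    (Vᴴ * V).det * minorOn (V * (Vᴴ * V)⁻¹ * Vᴴ) I J =
      ∑ K ∈ Finset.powersetCard q (Finset.univ \ (I ∪ J)),
            (-1 : ℂ) ^ (pairInv I K + pairInv J K) *
              rowMinor V (I ∪ K) * (starRingEnd ℂ) (rowMinor V (J ∪ K)) := by
  have hG := gram_isUnit V hV
  subst hk
  have hGne : (Vᴴ * V).det ≠ 0 := hG.ne_zero
  set G := Vᴴ * V with hGdef
  set P := V * G⁻¹ * Vᴴ with hPdef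
  have hP : P * P = P := by
    have : P * P = V * G⁻¹ * (Vᴴ * V) * G⁻¹ * Vᴴ := by simp only [hPdef, Matrix.mul_assoc]
    rw [this, ← hGdef, nonsing_inv_mul_cancel_right _ _ hG]
  have htr : P.trace = ((I.card + q : ℕ) : ℂ) := by
    rw [hPdef, trace_mul_comm, ← Matrix.mul_assoc, ← hGdef, mul_nonsing_inv _ hG]
    simp
  have hm : minorOn P I J = det (P.submatrix (I.orderEmbOfFin rfl) (J.orderEmbOfFin hJ)) := by
    rw [minorOn, dif_pos hJ]; rfl
  have key := proj_iter P hP _ htr q (Fin I.card) (I.orderEmbOfFin rfl) (J.orderEmbOfFin hJ)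
    (by simp)
  rw [← hm] at key
  have hF : ∀ (a b : Fin (I.card + q) → Fin n), det (P.submatrix a b) =
      det (V.submatrix a id) * G.det⁻¹ * star (det (V.submatrix b id)) := by
    intro a b
    have : P.submatrix a b = V.submatrix a id * G⁻¹ * (V.submatrix b id)ᴴ := by
      ext x y
      simp [hPdef, mul_apply]
    rw [this, det_mul, det_mul, det_conjTranspose, det_nonsing_inv, Ring.inverse_eq_inv']
  have key2 := sum_fun_to_sets (q := q) (I ∪ J)
    (fun g => det (P.submatrix (Sum.elim (I.orderEmbOfFin rfl) g) (Sum.elim (J.orderEmbOfFin hJ) g)))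
    (fun K => G.det⁻¹ * ((-1 : ℂ) ^ (pairInv I K + pairInv J K) *
              rowMinor V (I ∪ K) * (starRingEnd ℂ) (rowMinor V (J ∪ K)))) ?_ ?_ ?_ ?_
  · rw [key, ← Finset.mul_sum] at key2
    have := mul_left_cancel₀ (by exact_mod_cast q.factorial_ne_zero) key2
    rw [this, mul_inv_cancel_left₀ hGne]
  · intro g hg
    simp only [Function.Injective, not_forall] at hg
    obtain ⟨x, y, hxy, hne⟩ := hg
    apply det_zero_of_row_eq (i := Sum.inr x) (j := Sum.inr y) (by simpa using hne)
    ext z; simp [hxy]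
  · intro g x hx
    rcases Finset.mem_union.1 hx with hx | hx
    · rw [← Finset.mem_coe, ← Finset.range_orderEmbOfFin I rfl] at hx
      obtain ⟨y, hy⟩ := hx
      apply det_zero_of_row_eq (i := Sum.inr x) (j := Sum.inl y) (by simp)
      ext z; simp [hy]
    · rw [← Finset.mem_coe, ← Finset.range_orderEmbOfFin J hJ] at hx
      obtain ⟨y, hy⟩ := hx
      apply det_zero_of_column_eq (i := Sum.inr x) (j := Sum.inl y) (by simp)
      intro z; simp [hy]
  · intro g σ
    show det _ = det _
    rw [← det_submatrix_equiv_self (Equiv.sumCongr (Equiv.refl (Fin I.card)) σ)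
      (P.submatrix (Sum.elim (I.orderEmbOfFin rfl) g) (Sum.elim (J.orderEmbOfFin hJ) g)),
      submatrix_submatrix]
    congr 2
    · ext (x | x) <;> simp
    · ext (x | x) <;> simp
  · intro K hK hd
    rw [Finset.disjoint_union_left] at hd
    show det _ = _
    rw [← det_submatrix_equiv_self finSumFinEquiv.symm, submatrix_submatrix]
    have e : ∀ (a : Fin I.card → Fin n) (b : Fin q → Fin n),
        Sum.elim a b ∘ finSumFinEquiv.symm = Fin.append a b := by
      intro a b
      ext x
      induction x using Fin.addCases <;> simp
    rw [e, e, hF, rowMinor_append V I K rfl hK hd.1, rowMinor_append V J K hJ hK hd.2, pow_add]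
    simp
    ring

theorem projection_minor_formula {n k : ℕ} (V : Matrix (Fin n) (Fin k) ℂ)
    (hV : V.rank = k) :
    (∀ l : ℕ, 1 ≤ l → l ≤ n → ∀ I J : Finset (Fin n), I.card = l → J.card = l →
      minorOn (V * (V.conjTranspose * V)⁻¹ * V.conjTranspose) I J =
        (∑ K ∈ Finset.powersetCard (k - l) (Finset.univ \ (I ∪ J)),
            (-1 : ℂ) ^ (pairInv I K + pairInv J K) *
              rowMinor V (I ∪ K) * (starRingEnd ℂ) (rowMinor V (J ∪ K))) /
          (∑ K' ∈ Finset.powersetCard k (Finset.univ : Finset (Fin n)),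
            (Complex.normSq (rowMinor V K') : ℂ))) ∧
    (∀ I J : Finset (Fin n), I.card = k → J.card = k →
      minorOn (V * (V.conjTranspose * V)⁻¹ * V.conjTranspose) I J =
        rowMinor V I * (starRingEnd ℂ) (rowMinor V J) /
          (∑ K' ∈ Finset.powersetCard k (Finset.univ : Finset (Fin n)),
            (Complex.normSq (rowMinor V K') : ℂ))) := by
  have hG : (Vᴴ * V).det ≠ 0 := (gram_isUnit V hV).ne_zero
  have hden : (∑ K' ∈ Finset.powersetCard k (Finset.univ : Finset (Fin n)),
            (Complex.normSq (rowMinor V K') : ℂ)) = (Vᴴ * V).det := by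
    have h := main_minor (q := k) V hV ∅ ∅ rfl (by simp)
    have h1 : minorOn (V * (Vᴴ * V)⁻¹ * Vᴴ) ∅ ∅ = 1 := by
      rw [minorOn, dif_pos rfl]
      haveI : IsEmpty (Fin (∅ : Finset (Fin n)).card) := by
        rw [Finset.card_empty]; infer_instance
      exact det_isEmpty
    rw [h1, mul_one] at h
    rw [h]
    simp [pairInv, Complex.mul_conj]
  rw [hden]
  constructor
  · intro l _ _ I J hI hJ
    rw [eq_div_iff hG, mul_comm]
    rcases le_or_gt l k with hlk | hlk
    · exact main_minor V hV I J (hJ.trans hI.symm) (by omega)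
    · have e1 : ∀ K ∈ Finset.powersetCard (k - l) (Finset.univ \ (I ∪ J)),
          (-1 : ℂ) ^ (pairInv I K + pairInv J K) *
              rowMinor V (I ∪ K) * (starRingEnd ℂ) (rowMinor V (J ∪ K)) = 0 := by
        intro K _
        have : rowMinor V (I ∪ K) = 0 := by
          rw [rowMinor, dif_neg]
          have := Finset.card_le_card (Finset.subset_union_left (s₁ := I) (s₂ := K))
          omega
        rw [this]; simp
      rw [Finset.sum_eq_zero e1]
      have hJ' : J.card = I.card := hJ.trans hI.symm
      have e2 : minorOn (V * (Vᴴ * V)⁻¹ * Vᴴ) I J = 0 := by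
        rw [minorOn, dif_pos hJ']
        by_contra hne
        have hr := rank_of_det_ne_zero hne
        have h3 : (of fun a b : Fin I.card => (V * (Vᴴ * V)⁻¹ * Vᴴ)
            (I.orderIsoOfFin rfl a : Fin n) (J.orderIsoOfFin hJ' b : Fin n)) =
            ((V * (Vᴴ * V)⁻¹).submatrix (fun a => (I.orderIsoOfFin rfl a : Fin n)) id) *
            (Vᴴ.submatrix id (fun a => (J.orderIsoOfFin hJ' a : Fin n))) := by
          ext x y
          simp [mul_apply]
        rw [h3] at hr
        have h4 := (rank_mul_le_left ((V * (Vᴴ * V)⁻¹).submatrix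
          (fun a => (I.orderIsoOfFin rfl a : Fin n)) id)
          (Vᴴ.submatrix id (fun a => (J.orderIsoOfFin hJ' a : Fin n)))).trans (rank_le_card_width _)
        rw [hr] at h4
        simp at h4
        omega
      rw [e2, mul_zero]
  · intro I J hI hJ
    rw [eq_div_iff hG, mul_comm, main_minor (q := 0) V hV I J (hJ.trans hI.symm) (by omega)]
    simp [pairInv]
end
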